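/- arXiv:1812.10326 — 2 statements merged into one kernel-verified Lean document; each statement's English description precedes it below -/
import Mathlib

section
/- For every choice profile Ch such that under every college's choice function contracts are observable substitutes for monotone preferences and the observable law of aggregate demand for monotone preferences holds, there exist a DA-equivalent choice profile Ch', a finite set Σ ⊆ ℝ_{>0}, utility functions (u_c)_{c∈C} for colleges, and, for each monotone strict preference profile ≽ of the students, utility functions (u_s)_{s∈S} for students, together with an isomorphism in the sense of Jagadeesan between the market (Ch',≽) and the Kelso-Crawford economy (Σ,u). -/
open scoped Classical

namespace MWC

variable {C S T : Type*} [DecidableEq C] [DecidableEq S] [DecidableEq T] [LinearOrder T]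

/-! Contracts are triples `(college, student, term)`.  For `x : C × S × T`,
`x.1` is the college, `x.2.1` the student and `x.2.2` the contract term.
The linear order on `T` plays the role of `▷`: higher terms are better for students. -/

variable (X : Finset (C × S × T))

/-- The contracts in `X` naming college `c` (the set `X_c`). -/
def Xc (c : C) : Finset (C × S × T) := X.filter fun x => x.1 = c

/-- A set of contracts containing at most one contract per student. -/
def IsAlloc (Y : Finset (C × S × T)) : Prop :=
  ∀ x ∈ Y, ∀ y ∈ Y, x.2.1 = y.2.1 → x = y

/-- `Ch` is a valid choice function for college `c`: from each subset of `X_c` it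
chooses a subset with at most one contract per student, and it satisfies the
irrelevance of rejected contracts (IRC). -/
def IsChoice (c : C) (Ch : Finset (C × S × T) → Finset (C × S × T)) : Prop :=
  (∀ Y, Y ⊆ Xc X c → Ch Y ⊆ Y) ∧
  (∀ Y, Y ⊆ Xc X c → IsAlloc (Ch Y)) ∧
  (∀ Y, Y ⊆ Xc X c → ∀ x ∈ Xc X c, x ∉ Y → x ∉ Ch (insert x Y) → Ch Y = Ch (insert x Y))

/-- The rejection function `R_c(Y) = Y \ Ch_c(Y)`. -/
def Rej (Ch : Finset (C × S × T) → Finset (C × S × T)) (Y : Finset (C × S × T)) :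
    Finset (C × S × T) := Y \ Ch Y

/-- Contracts are substitutes under `Ch` (for college `c`). -/
def Substitutes (c : C) (Ch : Finset (C × S × T) → Finset (C × S × T)) : Prop :=
  ∀ Y, Y ⊆ Xc X c → ∀ x ∈ Xc X c, ∀ z ∈ Xc X c, x ∉ Y → z ∉ Y →
    x ∈ Ch (insert z (insert x Y)) → x ∈ Ch (insert x Y)

/-- The law of aggregate demand for `Ch` (college `c`). -/
def LAD (c : C) (Ch : Finset (C × S × T) → Finset (C × S × T)) : Prop :=
  ∀ Z Y, Z ⊆ Y → Y ⊆ Xc X c → (Ch Z).card ≤ (Ch Y).card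

/-- `Y^min`: the contracts of `Y` that give each involved student his
`▷`-worst contract among his contracts in `Y`. -/
def Ymin (Y : Finset (C × S × T)) : Finset (C × S × T) :=
  Y.filter fun y => ∀ y' ∈ Y, y'.2.1 = y.2.1 → ¬ y'.2.2 < y.2.2

/-- `Ch` is monotone in contract terms: it always chooses from `Y^min`. -/
def MonotoneCh (c : C) (Ch : Finset (C × S × T) → Finset (C × S × T)) : Prop :=
  ∀ Y, Y ⊆ Xc X c → Ch Y ⊆ Ymin Y

/-- `us` represents a strict preference of student `s` over his contracts in `X`
together with the outside option (utility `0`), monotone in contract terms: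
a higher contract term is always strictly better. -/
def IsPref (s : S) (us : C × S × T → ℤ) : Prop :=
  (∀ x ∈ X, x.2.1 = s → us x ≠ 0) ∧
  (∀ x ∈ X, ∀ y ∈ X, x.2.1 = s → y.2.1 = s → x ≠ y → us x ≠ us y) ∧
  (∀ x ∈ X, ∀ y ∈ X, x.2.1 = s → y.2.1 = s → y.2.2 < x.2.2 → us y < us x)

/-- The utility student `s` derives from allocation `Y` (`0` = outside option). -/
def util (us : C × S × T → ℤ) (s : S) (Y : Finset (C × S × T)) : ℤ :=
  ∑ x ∈ Y.filter (fun x => x.2.1 = s), us x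

/-- Individual rationality of allocation `Y` in the market `(Ch, u)`. -/
def IndivRat (Ch : C → Finset (C × S × T) → Finset (C × S × T))
    (u : S → C × S × T → ℤ) (Y : Finset (C × S × T)) : Prop :=
  (∀ c, Y.filter (fun x => x.1 = c) = Ch c (Y.filter fun x => x.1 = c)) ∧
  ∀ y ∈ Y, 0 < u y.2.1 y

/-- College `c` together with allocation `Z` blocks allocation `Y`. -/
def Blocks (Ch : C → Finset (C × S × T) → Finset (C × S × T))
    (u : S → C × S × T → ℤ) (c : C) (Z Y : Finset (C × S × T)) : Prop :=
  Z ⊆ X ∧ IsAlloc Z ∧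
  Z.filter (fun x => x.1 = c) ≠ Y.filter (fun x => x.1 = c) ∧
  Z.filter (fun x => x.1 = c) = Ch c ((Y ∪ Z).filter fun x => x.1 = c) ∧
  ∀ z ∈ Z.filter (fun x => x.1 = c), util (u z.2.1) z.2.1 Y ≤ u z.2.1 z

/-- Stability of allocation `Y` in the market `(Ch, u)`. -/
def Stable (Ch : C → Finset (C × S × T) → Finset (C × S × T))
    (u : S → C × S × T → ℤ) (Y : Finset (C × S × T)) : Prop :=
  Y ⊆ X ∧ IsAlloc Y ∧ IndivRat Ch u Y ∧ ¬ ∃ c Z, Blocks X Ch u c Z Y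

/-- The contracts proposed when `D` is the set of contracts rejected so far:
every student proposes his most preferred acceptable not-yet-rejected contract. -/
def proposals (u : S → C × S × T → ℤ) (D : Finset (C × S × T)) : Finset (C × S × T) :=
  (X \ D).filter fun x =>
    0 < u x.2.1 x ∧ ∀ y ∈ X \ D, y.2.1 = x.2.1 → u x.2.1 y ≤ u x.2.1 x

/-- The contracts tentatively held by the colleges among the proposals `P`:
each college `c` keeps its choice from the contracts proposed to it. -/
def held (Ch : C → Finset (C × S × T) → Finset (C × S × T))
    (P : Finset (C × S × T)) : Finset (C × S × T) :=
  P.filter fun x => x ∈ Ch x.1 (P.filter fun y => y.1 = x.1)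

/-- One round of the student-proposing deferred acceptance algorithm, acting on the
cumulative set of rejected contracts. -/
def step (Ch : C → Finset (C × S × T) → Finset (C × S × T))
    (u : S → C × S × T → ℤ) (D : Finset (C × S × T)) : Finset (C × S × T) :=
  D ∪ (proposals X u D \ held Ch (proposals X u D))

/-- The outcome `DA(Ch, u)` of the student-proposing deferred acceptance algorithm
(the algorithm reaches a fixed point after at most `|X| + 1` rounds). -/
def DA (Ch : C → Finset (C × S × T) → Finset (C × S × T))
    (u : S → C × S × T → ℤ) : Finset (C × S × T) :=
  held Ch (proposals X u ((step X Ch u)^[X.card + 1] ∅))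

/-- The cumulative set of contracts proposed up to round `t` of the deferred
acceptance algorithm. -/
def cumProposed (Ch : C → Finset (C × S × T) → Finset (C × S × T))
    (u : S → C × S × T → ℤ) (t : ℕ) : Finset (C × S × T) :=
  (Finset.range (t + 1)).biUnion fun r => proposals X u ((step X Ch u)^[r] ∅)

/-- Two choice profiles are deferred-acceptance-equivalent if the DA algorithm
produces the same outcome under both, for every profile of strict preferences
monotone in contract terms. -/
def DAeq (Ch Ch' : C → Finset (C × S × T) → Finset (C × S × T)) : Prop :=
  ∀ u : S → C × S × T → ℤ, (∀ s, IsPref X s (u s)) → DA X Ch u = DA X Ch' u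

/-- `Ch` is DA-stable: the DA outcome is stable for every profile of strict
preferences monotone in contract terms. -/
def DAStable (Ch : C → Finset (C × S × T) → Finset (C × S × T)) : Prop :=
  ∀ u : S → C × S × T → ℤ, (∀ s, IsPref X s (u s)) → Stable X Ch u (DA X Ch u)

/-- Mechanism `M` is `Ch`-stable. -/
def StableMech (Ch : C → Finset (C × S × T) → Finset (C × S × T))
    (M : (S → C × S × T → ℤ) → Finset (C × S × T)) : Prop :=
  ∀ u : S → C × S × T → ℤ, (∀ s, IsPref X s (u s)) → Stable X Ch u (M u)

/-- Strategy-proofness of a mechanism on the domain of strict preferences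
monotone in contract terms. -/
def SP (M : (S → C × S × T → ℤ) → Finset (C × S × T)) : Prop :=
  ∀ u u' : S → C × S × T → ℤ, (∀ s, IsPref X s (u s)) → (∀ s, IsPref X s (u' s)) →
    ∀ s : S, (∀ s', s' ≠ s → u' s' = u s') →
      util (u s) s (M u') ≤ util (u s) s (M u)

/-- Group-strategy-proofness of a mechanism on the domain of strict preferences
monotone in contract terms. -/
def GSP (M : (S → C × S × T → ℤ) → Finset (C × S × T)) : Prop :=
  ∀ u u' : S → C × S × T → ℤ, (∀ s, IsPref X s (u s)) → (∀ s, IsPref X s (u' s)) →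
    ∀ S' : Set S, S'.Nonempty → (∀ s, s ∉ S' → u' s = u s) →
      ∃ s' ∈ S', util (u s') s' (M u') ≤ util (u s') s' (M u)

/-- The sequence `L` consists of contracts in `X_c`. -/
def SeqIn (c : C) (L : List (C × S × T)) : Prop := ∀ x ∈ L, x ∈ Xc X c

/-- The sequence `L` is generated from monotone preferences: every contract (of the
relevant college) with the same student and a strictly higher term than the `t`-th
element appears among the first `t` elements. -/
def GenMono (c : C) (L : List (C × S × T)) : Prop :=
  ∀ (t : ℕ) (ht : t < L.length), ∀ x ∈ Xc X c, x.2.1 = (L.get ⟨t, ht⟩).2.1 →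
    (L.get ⟨t, ht⟩).2.2 < x.2.2 → x ∈ L.take t

/-- The sequence `L` is observable under `Ch`: the student of each next contract is
not among the students currently chosen by `Ch`. -/
def ObsSeq (Ch : Finset (C × S × T) → Finset (C × S × T)) (L : List (C × S × T)) : Prop :=
  ∀ (t : ℕ) (ht : t < L.length), 0 < t →
    (L.get ⟨t, ht⟩).2.1 ∉ (Ch (L.take t).toFinset).image fun y => y.2.1

/-- Observable substitutability for monotone preferences. -/
def ObsSub (c : C) (Ch : Finset (C × S × T) → Finset (C × S × T)) : Prop :=
  ∀ L : List (C × S × T), SeqIn X c L → GenMono X c L → ObsSeq Ch L →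
    ∀ t : ℕ, t + 1 ≤ L.length →
      Rej Ch (L.take t).toFinset ⊆ Rej Ch (L.take (t + 1)).toFinset

/-- The observable law of aggregate demand for monotone preferences. -/
def ObsLAD (c : C) (Ch : Finset (C × S × T) → Finset (C × S × T)) : Prop :=
  ∀ L : List (C × S × T), SeqIn X c L → GenMono X c L → ObsSeq Ch L →
    ∀ t : ℕ, t + 1 ≤ L.length →
      (Ch (L.take t).toFinset).card ≤ (Ch (L.take (t + 1)).toFinset).card

/-- `Y` is an observable set under `Ch`. -/
def ObsSet (c : C) (Ch : Finset (C × S × T) → Finset (C × S × T))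
    (Y : Finset (C × S × T)) : Prop :=
  ∃ L : List (C × S × T), L.Nodup ∧ L.toFinset = Y ∧ SeqIn X c L ∧
    GenMono X c L ∧ ObsSeq Ch L

/-- `Ytil` is a maximal observable subset of `Y` under `Ch`. -/
def MaxObsSubset (c : C) (Ch : Finset (C × S × T) → Finset (C × S × T))
    (Y Ytil : Finset (C × S × T)) : Prop :=
  Ytil ⊆ Y ∧ ObsSet X c Ch Ytil ∧
    ∀ Y', ObsSet X c Ch Y' → Ytil ⊆ Y' → Y' ⊆ Y → Y' = Ytil

/-- `U(Y)`: the contracts in `X_c` that are at least as good for the involved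
student as some contract of his in `Y`. -/
def Uset (c : C) (Y : Finset (C × S × T)) : Finset (C × S × T) :=
  (Xc X c).filter fun x => ∃ y ∈ Y, x.2.1 = y.2.1 ∧ (y.2.2 < x.2.2 ∨ x = y)

/-- `Y^∨`: the (under observable substitutability unique) maximal observable subset
of `U(Y)` under `Ch`. -/
noncomputable def vee (c : C) (Ch : Finset (C × S × T) → Finset (C × S × T))
    (Y : Finset (C × S × T)) : Finset (C × S × T) :=
  if h : ∃ V, MaxObsSubset X c Ch (Uset X c Y) V then h.choose else ∅

/-- The virtual choice function
`Ch'_c(Y) = { x ∈ Y^min : x_S ∈ [Ch_c(Y^∨)]_S }`. -/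
noncomputable def virtualChoice (c : C) (Ch : Finset (C × S × T) → Finset (C × S × T))
    (Y : Finset (C × S × T)) : Finset (C × S × T) :=
  (Ymin Y).filter fun x => x.2.1 ∈ (Ch (vee X c Ch Y)).image fun y => y.2.1

/-! ### Observable sets and confluence of offer processes -/

/-- `x` is a valid next offer after the offers `Z`. -/
def Valid (c : C) (ch : Finset (C × S × T) → Finset (C × S × T))
    (Z : Finset (C × S × T)) (x : C × S × T) : Prop :=
  x ∈ Xc X c ∧ x ∉ Z ∧
  (∀ y ∈ Xc X c, y.2.1 = x.2.1 → x.2.2 < y.2.2 → y ∈ Z) ∧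
  ∀ y ∈ ch Z, y.2.1 ≠ x.2.1

def Stp (c : C) (ch : Finset (C × S × T) → Finset (C × S × T))
    (Z W : Finset (C × S × T)) : Prop := ∃ x, Valid X c ch Z x ∧ W = insert x Z

def Reach (c : C) (ch : Finset (C × S × T) → Finset (C × S × T))
    (Z W : Finset (C × S × T)) : Prop := Relation.ReflTransGen (Stp X c ch) Z W

def Obs (c : C) (ch : Finset (C × S × T) → Finset (C × S × T))
    (Z : Finset (C × S × T)) : Prop := Reach X c ch ∅ Z

lemma Xc_ext {c : C} {x y : C × S × T} (hx : x ∈ Xc X c) (hy : y ∈ Xc X c)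
    (h1 : x.2.1 = y.2.1) (h2 : x.2.2 = y.2.2) : x = y := by
  simp only [Xc, Finset.mem_filter] at hx hy
  exact Prod.ext (hx.2.trans hy.2.symm) (Prod.ext h1 h2)

section obs
variable {X} {c : C} {ch : Finset (C × S × T) → Finset (C × S × T)}

lemma Obs.subset {Z : Finset (C × S × T)} (h : Obs X c ch Z) : Z ⊆ Xc X c := by
  unfold Obs Reach at h
  induction h with
  | refl => simp
  | tail _ h ih =>
    obtain ⟨x, hx, rfl⟩ := h
    exact Finset.insert_subset hx.1 ih

lemma Obs.up {Z : Finset (C × S × T)} (h : Obs X c ch Z) :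
    ∀ y ∈ Z, ∀ x ∈ Xc X c, x.2.1 = y.2.1 → y.2.2 < x.2.2 → x ∈ Z := by
  unfold Obs Reach at h
  induction h with
  | refl => simp
  | tail _ h ih =>
    obtain ⟨z, hz, rfl⟩ := h
    intro y hy x hx h1 h2
    rcases Finset.mem_insert.1 hy with rfl | hy
    · exact Finset.mem_insert_of_mem (hz.2.2.1 x hx h1 h2)
    · exact Finset.mem_insert_of_mem (ih y hy x hx h1 h2)

lemma list_append {L : List (C × S × T)} {x} (h1 : SeqIn X c L) (h2 : GenMono X c L)
    (h3 : ObsSeq ch L) (hx : Valid X c ch L.toFinset x) :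
    SeqIn X c (L ++ [x]) ∧ GenMono X c (L ++ [x]) ∧ ObsSeq ch (L ++ [x]) := by
  refine ⟨?_, ?_, ?_⟩
  · intro y hy
    rcases List.mem_append.1 hy with hy | hy
    · exact h1 y hy
    · rw [List.mem_singleton.1 hy]; exact hx.1
  · intro t ht y hy
    rcases Nat.lt_or_ge t L.length with htl | htl
    · have := h2 t htl y hy
      simp only [List.get_eq_getElem] at this ⊢
      rw [List.getElem_append_left htl, List.take_append_of_le_length htl.le]
      exact this
    · have htl' : t = L.length := by simp at ht; omega
      subst htl'
      have := hx.2.2.1 y hy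
      simp only [List.get_eq_getElem]
      simpa using this
  · intro t ht h0
    rcases Nat.lt_or_ge t L.length with htl | htl
    · have := h3 t htl h0
      simp only [List.get_eq_getElem] at this ⊢
      rw [List.getElem_append_left htl, List.take_append_of_le_length htl.le]
      exact this
    · have htl' : t = L.length := by simp at ht; omega
      subst htl'
      have := hx.2.2.2
      simp only [List.get_eq_getElem, Finset.mem_image, not_exists, not_and]
      simpa using this

lemma Obs.list {Z : Finset (C × S × T)} (h : Obs X c ch Z) :
    ∃ L : List (C × S × T), L.toFinset = Z ∧ SeqIn X c L ∧ GenMono X c L ∧ ObsSeq ch L := by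
  unfold Obs Reach at h
  induction h with
  | refl => exact ⟨[], by simp [SeqIn, GenMono, ObsSeq]⟩
  | tail _ h ih =>
    obtain ⟨z, hz, rfl⟩ := h
    obtain ⟨L, rfl, h1, h2, h3⟩ := ih
    exact ⟨L ++ [z], by ext a; simp [or_comm], list_append h1 h2 h3 hz⟩

variable (hobs : ObsSub X c ch) (hlad : ObsLAD X c ch) (hch : IsChoice X c ch)

lemma Obs.cons {Z : Finset (C × S × T)} {x} (h : Obs X c ch Z) (hx : Valid X c ch Z x) :
    Obs X c ch (insert x Z) := Relation.ReflTransGen.tail h ⟨x, hx, rfl⟩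

lemma Obs.trans {Z W : Finset (C × S × T)} (h : Obs X c ch Z) (hx : Reach X c ch Z W) :
    Obs X c ch W := Relation.ReflTransGen.trans h hx

include hobs in
lemma Obs.rej_step {Z : Finset (C × S × T)} {x} (h : Obs X c ch Z) (hx : Valid X c ch Z x) :
    Rej ch Z ⊆ Rej ch (insert x Z) := by
  obtain ⟨L, rfl, h1, h2, h3⟩ := h.list
  obtain ⟨k1, k2, k3⟩ := list_append h1 h2 h3 hx
  have := hobs _ k1 k2 k3 L.length (by simp)
  have e : (L ++ [x]).toFinset = insert x L.toFinset := by ext a; simp [or_comm]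
  rw [List.take_append_of_le_length le_rfl, List.take_length,
    List.take_of_length_le (by simp), e] at this
  exact this

include hlad in
lemma Obs.card_step {Z : Finset (C × S × T)} {x} (h : Obs X c ch Z) (hx : Valid X c ch Z x) :
    (ch Z).card ≤ (ch (insert x Z)).card := by
  obtain ⟨L, rfl, h1, h2, h3⟩ := h.list
  obtain ⟨k1, k2, k3⟩ := list_append h1 h2 h3 hx
  have := hlad _ k1 k2 k3 L.length (by simp)
  have e : (L ++ [x]).toFinset = insert x L.toFinset := by ext a; simp [or_comm]
  rw [List.take_append_of_le_length le_rfl, List.take_length,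
    List.take_of_length_le (by simp), e] at this
  exact this

include hobs hch in
lemma diamond {Z : Finset (C × S × T)} {x y} (h : Obs X c ch Z) (hx : Valid X c ch Z x)
    (hy : Valid X c ch Z y) (hne : y ≠ x) : Valid X c ch (insert x Z) y := by
  have hs : x.2.1 ≠ y.2.1 := by
    intro hs
    rcases lt_trichotomy x.2.2 y.2.2 with h1 | h1 | h1
    · exact hy.2.1 (hx.2.2.1 y hy.1 hs.symm h1)
    · exact hne (Xc_ext X hx.1 hy.1 hs h1).symm
    · exact hx.2.1 (hy.2.2.1 x hx.1 hs h1)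
  refine ⟨hy.1, ?_, ?_, ?_⟩
  · simp [hne, hy.2.1]
  · intro z hz h1 h2
    exact Finset.mem_insert_of_mem (hy.2.2.1 z hz h1 h2)
  · intro z hz hzs
    have hzi := hch.1 _ (h.cons hx).subset hz
    rcases Finset.mem_insert.1 hzi with rfl | hzZ
    · exact hs hzs
    · have : z ∈ Rej ch Z := by
        rw [Rej, Finset.mem_sdiff]
        exact ⟨hzZ, fun hh => hy.2.2.2 z hh hzs⟩
      have := h.rej_step hobs hx this
      rw [Rej, Finset.mem_sdiff] at this
      exact this.2 hz

include hobs hch in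
lemma strip {V W : Finset (C × S × T)} {x} (h : Obs X c ch V) (hx : Valid X c ch V x)
    (hr : Reach X c ch V W) :
    Reach X c ch (insert x V) (insert x W) ∧ (x ∈ W ∨ Valid X c ch W x) := by
  unfold Reach at hr
  induction hr with
  | refl => exact ⟨Relation.ReflTransGen.refl, Or.inr hx⟩
  | @tail W W' hr hst ih =>
    obtain ⟨y, hy, rfl⟩ := hst
    obtain ⟨i1, i2⟩ := ih
    have hW : Obs X c ch W := h.trans hr
    rcases i2 with i2 | i2
    · rw [Finset.insert_eq_of_mem i2] at i1
      rw [Finset.insert_eq_of_mem (Finset.mem_insert_of_mem i2)]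
      exact ⟨i1.tail ⟨y, hy, rfl⟩, Or.inl (Finset.mem_insert_of_mem i2)⟩
    · by_cases hyx : y = x
      · subst hyx
        simpa using i1
      · refine ⟨?_, Or.inr (diamond hobs hch hW hy i2 (Ne.symm hyx))⟩
        rw [Finset.insert_comm]
        exact i1.tail ⟨y, diamond hobs hch hW i2 hy hyx, rfl⟩

include hobs hch in
lemma union_reach {Z V : Finset (C × S × T)} (hZ : Obs X c ch Z) (hV : Obs X c ch V) :
    Reach X c ch Z (Z ∪ V) ∧ Reach X c ch V (Z ∪ V) := by
  have hV' := hV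
  unfold Obs at hV
  unfold Reach at hV
  induction hV with
  | refl => simpa using ⟨Relation.ReflTransGen.refl, hZ⟩
  | @tail V V' hr hst ih =>
    obtain ⟨x, hx, rfl⟩ := hst
    obtain ⟨i1, i2⟩ := ih hr
    obtain ⟨j1, j2⟩ := strip hobs hch hr hx i2
    rw [Finset.union_insert]
    refine ⟨?_, j1⟩
    rcases j2 with j2 | j2
    · rw [Finset.insert_eq_of_mem j2]; exact i1
    · exact i1.tail ⟨x, j2, rfl⟩

include hobs hch in
lemma Obs.union {Z V : Finset (C × S × T)} (hZ : Obs X c ch Z) (hV : Obs X c ch V) :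
    Obs X c ch (Z ∪ V) := hZ.trans (union_reach hobs hch hZ hV).1

include hobs hch in
lemma Obs.reach {Z V : Finset (C × S × T)} (hZ : Obs X c ch Z) (hV : Obs X c ch V)
    (h : Z ⊆ V) : Reach X c ch Z V := by
  have := (union_reach hobs hch hZ hV).1
  rwa [Finset.union_eq_right.2 h] at this

include hobs hch in
lemma Obs.rej_mono {Z V : Finset (C × S × T)} (hZ : Obs X c ch Z) (hV : Obs X c ch V)
    (h : Z ⊆ V) : Rej ch Z ⊆ Rej ch V := by
  have hr := hZ.reach hobs hch hV h
  unfold Reach at hr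
  clear hV h
  induction hr with
  | refl => exact le_rfl
  | tail hr hst ih =>
    obtain ⟨x, hx, rfl⟩ := hst
    exact ih.trans (Obs.rej_step hobs (hZ.trans hr) hx)

include hobs hch hlad in
lemma Obs.card_mono {Z V : Finset (C × S × T)} (hZ : Obs X c ch Z) (hV : Obs X c ch V)
    (h : Z ⊆ V) : (ch Z).card ≤ (ch V).card := by
  have hr := hZ.reach hobs hch hV h
  unfold Reach at hr
  clear hV h
  induction hr with
  | refl => exact le_rfl
  | tail hr hst ih =>
    obtain ⟨x, hx, rfl⟩ := hst
    exact ih.trans (Obs.card_step hlad (hZ.trans hr) hx)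

include hobs hch in
lemma Obs.union_valid {Z B : Finset (C × S × T)} (hZ : Obs X c ch Z)
    (hB : ∀ x ∈ B, x ∈ Z ∨ Valid X c ch Z x) : Obs X c ch (Z ∪ B) := by
  induction B using Finset.induction_on with
  | empty => simpa using hZ
  | insert b B _ ih =>
    have i := ih fun x hx => hB x (Finset.mem_insert_of_mem hx)
    have hb : Obs X c ch (insert b Z) := by
      rcases hB b (Finset.mem_insert_self _ _) with h | h
      · rwa [Finset.insert_eq_of_mem h]
      · exact hZ.cons h
    have := i.union hobs hch hb
    have e : Z ∪ B ∪ insert b Z = Z ∪ insert b B := by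
      ext a; simp only [Finset.mem_union, Finset.mem_insert]; tauto
    rwa [e] at this

include hobs hch in
lemma Obs.ch_min {Z : Finset (C × S × T)} (hZ : Obs X c ch Z) : ch Z ⊆ Ymin Z := by
  have hZ' := hZ
  unfold Obs Reach at hZ
  induction hZ with
  | refl =>
    have := hch.1 ∅ (by simp)
    intro x hx; simpa using this hx
  | @tail Z Z' hr hst ih =>
    obtain ⟨x, hx, rfl⟩ := hst
    have hO : Obs X c ch Z := hr
    have ih := ih hr
    intro y hy
    have hyi := hch.1 _ hZ'.subset hy
    rw [Ymin, Finset.mem_filter]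
    refine ⟨hyi, ?_⟩
    intro y' hy' hs hlt
    rcases Finset.mem_insert.1 hyi with rfl | hyZ
    · rcases Finset.mem_insert.1 hy' with rfl | hy'
      · exact lt_irrefl _ hlt
      · exact hx.2.1 (hO.up y' hy' y hx.1 hs.symm hlt)
    · have hyc : y ∈ ch Z := by
        by_contra hn
        have : y ∈ Rej ch Z := Finset.mem_sdiff.2 ⟨hyZ, hn⟩
        exact (Finset.mem_sdiff.1 (hO.rej_step hobs hx this)).2 hy
      rcases Finset.mem_insert.1 hy' with rfl | hy'
      · exact hx.2.2.2 y hyc hs.symm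
      · exact (Finset.mem_filter.1 (ih hyc)).2 y' hy' hs hlt

/-! ### The virtual choice function -/

/-- The largest observable subset. -/
noncomputable def mvee (X : Finset (C × S × T)) (c : C)
    (ch : Finset (C × S × T) → Finset (C × S × T))
    (U : Finset (C × S × T)) : Finset (C × S × T) :=
  (U.powerset.filter fun Z => Obs X c ch Z).sup id

noncomputable def vch (X : Finset (C × S × T)) (c : C)
    (ch : Finset (C × S × T) → Finset (C × S × T))
    (Y : Finset (C × S × T)) : Finset (C × S × T) :=
  (Ymin Y).filter fun x => ∃ y ∈ ch (mvee X c ch (Uset X c Y)), y.2.1 = x.2.1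

lemma mvee_subset (U : Finset (C × S × T)) : mvee X c ch U ⊆ U := by
  refine Finset.sup_le fun Z hZ => ?_
  exact Finset.mem_powerset.1 (Finset.mem_filter.1 hZ).1

lemma le_mvee {U Z : Finset (C × S × T)} (h : Obs X c ch Z) (hZ : Z ⊆ U) :
    Z ⊆ mvee X c ch U :=
  Finset.le_sup (f := id) (Finset.mem_filter.2 ⟨Finset.mem_powerset.2 hZ, h⟩)

include hobs hch in
lemma obs_mvee (U : Finset (C × S × T)) : Obs X c ch (mvee X c ch U) := by
  unfold mvee
  refine Finset.sup_induction (p := Obs X c ch) Relation.ReflTransGen.refl ?_ ?_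
  · intro a ha b hb
    exact ha.union hobs hch hb
  · intro Z hZ
    exact (Finset.mem_filter.1 hZ).2

include hobs hch in
lemma mvee_not_valid {U : Finset (C × S × T)} {x} (hx : x ∈ U) :
    ¬ Valid X c ch (mvee X c ch U) x := by
  intro hv
  have h := (obs_mvee hobs hch U).cons hv
  exact hv.2.1 (le_mvee h (Finset.insert_subset hx (mvee_subset U)) (Finset.mem_insert_self _ _))

include hobs hch in
lemma mvee_full {U : Finset (C × S × T)} (hU : U ⊆ Xc X c)
    (hup : ∀ y ∈ U, ∀ x ∈ Xc X c, x.2.1 = y.2.1 → y.2.2 < x.2.2 → x ∈ U)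
    {x} (hx : x ∈ U) (hs : ∀ y ∈ ch (mvee X c ch U), y.2.1 ≠ x.2.1) :
    x ∈ mvee X c ch U := by
  by_contra hn
  have hne : ((U \ mvee X c ch U).filter fun y => y.2.1 = x.2.1).Nonempty :=
    ⟨x, by simp [hx, hn]⟩
  obtain ⟨z, hz, hmax⟩ := Finset.exists_max_image _ (fun y => y.2.2) hne
  simp only [Finset.mem_filter, Finset.mem_sdiff] at hz hmax
  refine mvee_not_valid hobs hch hz.1.1 ⟨hU hz.1.1, hz.1.2, ?_, ?_⟩
  · intro y hy h1 h2
    by_contra hyn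
    exact absurd (hmax y ⟨⟨hup z hz.1.1 y hy h1 h2, hyn⟩, h1.trans hz.2⟩) (not_le.2 h2)
  · intro y hy h1
    exact hs y hy (h1.trans hz.2)

lemma mem_Uset {Y : Finset (C × S × T)} {x} : x ∈ Uset X c Y ↔
    x ∈ Xc X c ∧ ∃ y ∈ Y, x.2.1 = y.2.1 ∧ (y.2.2 < x.2.2 ∨ x = y) := by
  simp [Uset]

lemma Uset_subset (Y : Finset (C × S × T)) : Uset X c Y ⊆ Xc X c :=
  fun _ hx => (mem_Uset.1 hx).1

lemma subset_Uset {Y : Finset (C × S × T)} (hY : Y ⊆ Xc X c) : Y ⊆ Uset X c Y :=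
  fun x hx => mem_Uset.2 ⟨hY hx, x, hx, rfl, Or.inr rfl⟩

lemma Uset_up (Y : Finset (C × S × T)) :
    ∀ y ∈ Uset X c Y, ∀ x ∈ Xc X c, x.2.1 = y.2.1 → y.2.2 < x.2.2 → x ∈ Uset X c Y := by
  intro y hy x hx h1 h2
  obtain ⟨hy, z, hz, h3, h4⟩ := mem_Uset.1 hy
  refine mem_Uset.2 ⟨hx, z, hz, h1.trans h3, Or.inl ?_⟩
  rcases h4 with h4 | rfl
  · exact h4.trans h2
  · exact h2

lemma Uset_mono {Y Y' : Finset (C × S × T)} (h : Y ⊆ Y') : Uset X c Y ⊆ Uset X c Y' := by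
  intro x hx
  obtain ⟨hx, z, hz, h3⟩ := mem_Uset.1 hx
  exact mem_Uset.2 ⟨hx, z, h hz, h3⟩

lemma Uset_le {Y Z : Finset (C × S × T)} (h : Y ⊆ Uset X c Z) : Uset X c Y ⊆ Uset X c Z := by
  intro x hx
  obtain ⟨hx, z, hz, h3, h4⟩ := mem_Uset.1 hx
  rcases h4 with h4 | rfl
  · exact Uset_up Z z (h hz) x hx h3 h4
  · exact h hz

lemma mem_Ymin {Y : Finset (C × S × T)} {x} : x ∈ Ymin Y ↔
    x ∈ Y ∧ ∀ y' ∈ Y, y'.2.1 = x.2.1 → ¬ y'.2.2 < x.2.2 := by simp [Ymin]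

lemma mem_vch {Y : Finset (C × S × T)} {x} : x ∈ vch X c ch Y ↔
    x ∈ Ymin Y ∧ ∃ y ∈ ch (mvee X c ch (Uset X c Y)), y.2.1 = x.2.1 := by simp [vch]

lemma Ymin_subset (Y : Finset (C × S × T)) : Ymin Y ⊆ Y := fun _ h => (mem_Ymin.1 h).1

lemma vch_subset_min (Y : Finset (C × S × T)) : vch X c ch Y ⊆ Ymin Y :=
  fun _ h => (mem_vch.1 h).1

lemma vch_subset (Y : Finset (C × S × T)) : vch X c ch Y ⊆ Y :=
  (vch_subset_min Y).trans (Ymin_subset Y)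

lemma Ymin_alloc {Y : Finset (C × S × T)} (hY : Y ⊆ Xc X c) : IsAlloc (Ymin Y) := by
  intro x hx y hy hs
  obtain ⟨hx, h1⟩ := mem_Ymin.1 hx
  obtain ⟨hy, h2⟩ := mem_Ymin.1 hy
  exact Xc_ext X (hY hx) (hY hy) hs
    (le_antisymm (not_lt.1 (h1 y hy hs.symm)) (not_lt.1 (h2 x hx hs)))

include hobs hch in
lemma vch_obs {Z : Finset (C × S × T)} (hZ : Obs X c ch Z) : vch X c ch Z = ch Z := by
  have hU : Uset X c Z = Z := by
    refine subset_antisymm ?_ (subset_Uset hZ.subset)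
    intro x hx
    obtain ⟨hx, z, hz, h3, h4⟩ := mem_Uset.1 hx
    rcases h4 with h4 | rfl
    · exact hZ.up z hz x hx h3 h4
    · exact hz
  have hV : mvee X c ch Z = Z := subset_antisymm (mvee_subset Z) (le_mvee hZ le_rfl)
  have hmin := hZ.ch_min hobs hch
  ext x
  rw [mem_vch, hU, hV]
  constructor
  · rintro ⟨hx, y, hy, hs⟩
    rw [← Ymin_alloc hZ.subset y (hmin hy) x hx hs]; exact hy
  · intro hx
    exact ⟨hmin hx, x, hx, rfl⟩

include hobs hch in
lemma vch_subst {Y Y' : Finset (C × S × T)} (hYY : Y ⊆ Y') (hY : Y' ⊆ Xc X c) {x}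
    (hx : x ∈ Y) (hxc : x ∈ vch X c ch Y') : x ∈ vch X c ch Y := by
  obtain ⟨hm, z, hz, hs⟩ := mem_vch.1 hxc
  obtain ⟨hxY', hmin⟩ := mem_Ymin.1 hm
  refine mem_vch.2 ⟨mem_Ymin.2 ⟨hx, fun y hy => hmin y (hYY hy)⟩, ?_⟩
  by_contra hn
  push Not at hn
  have hO := obs_mvee hobs hch (Uset X c Y)
  have hO' := obs_mvee hobs hch (Uset X c Y')
  have hzV' := hch.1 _ hO'.subset hz
  have hzU' := mvee_subset _ hzV'
  have hzmin : z ∈ Uset X c Y := by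
    obtain ⟨hzX, y, hy, h1, h2⟩ := mem_Uset.1 hzU'
    have hle : x.2.2 ≤ z.2.2 := by
      have := not_lt.1 (hmin y hy (h1.symm.trans hs))
      rcases h2 with h2 | rfl
      · exact this.trans h2.le
      · exact this
    refine mem_Uset.2 ⟨hzX, x, hx, hs, ?_⟩
    rcases hle.lt_or_eq with h | h
    · exact Or.inl h
    · exact Or.inr (Xc_ext X hzX (hY hxY') hs h.symm)
  have hzV := mvee_full hobs hch (Uset_subset Y) (Uset_up Y) hzmin
    (fun y hy h => hn y hy (h.trans hs))
  have hr : z ∈ Rej ch (mvee X c ch (Uset X c Y)) :=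
    Finset.mem_sdiff.2 ⟨hzV, fun h => hn z h hs⟩
  have := hO.rej_mono hobs hch hO' (le_mvee hO ((mvee_subset _).trans (Uset_mono hYY))) hr
  exact (Finset.mem_sdiff.1 this).2 hz

lemma choice_irc {ch : Finset (C × S × T) → Finset (C × S × T)} (hch : IsChoice X c ch)
    {Y Z : Finset (C × S × T)} (hYZ : Y ⊆ Z) (hZ : Z ⊆ Xc X c) (h : ch Z ⊆ Y) :
    ch Y = ch Z := by
  have key : ∀ B : Finset (C × S × T), B ⊆ Xc X c → ch (Y ∪ B) ⊆ Y → ch Y = ch (Y ∪ B) := by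
    intro B
    induction B using Finset.induction_on with
    | empty => simp
    | insert b B hb ih =>
      intro hB hc
      have hB' : B ⊆ Xc X c := (Finset.subset_insert _ _).trans hB
      have e : Y ∪ insert b B = insert b (Y ∪ B) := Finset.union_insert _ _ _
      rw [e] at hc ⊢
      by_cases hbY : b ∈ Y ∪ B
      · rw [Finset.insert_eq_of_mem hbY] at hc ⊢
        exact ih hB' hc
      · have := hch.2.2 (Y ∪ B) (Finset.union_subset (hYZ.trans hZ) hB') b
          (hB (Finset.mem_insert_self _ _)) hbY
          (fun hh => hbY (Finset.mem_union_left _ (hc hh)))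
        rw [← this] at hc ⊢
        exact ih hB' hc
  have := key Z hZ
  rw [Finset.union_eq_right.2 hYZ] at this
  exact this h

/-- adding a contract that is not minimal does not matter -/
lemma vch_insert_of_mem {Y : Finset (C × S × T)} {x} (hY : Y ⊆ Xc X c)
    (hx : x ∈ Uset X c Y) (hxY : x ∉ Y) : vch X c ch (insert x Y) = vch X c ch Y := by
  have hU : Uset X c (insert x Y) = Uset X c Y := by
    refine subset_antisymm (Uset_le (Finset.insert_subset hx (subset_Uset hY)))
      (Uset_mono (Finset.subset_insert _ _))
  have hm : Ymin (insert x Y) = Ymin Y := by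
    obtain ⟨hxX, y, hy, h1, h2⟩ := mem_Uset.1 hx
    have h2 : y.2.2 < x.2.2 := by
      rcases h2 with h2 | rfl
      · exact h2
      · exact absurd hy hxY
    ext z
    rw [mem_Ymin, mem_Ymin]
    constructor
    · rintro ⟨hz, h⟩
      rcases Finset.mem_insert.1 hz with rfl | hz
      · exact absurd h2 (h y (Finset.mem_insert_of_mem hy) h1.symm)
      · exact ⟨hz, fun w hw => h w (Finset.mem_insert_of_mem hw)⟩
    · rintro ⟨hz, h⟩
      refine ⟨Finset.mem_insert_of_mem hz, ?_⟩
      intro w hw hs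
      rcases Finset.mem_insert.1 hw with rfl | hw
      · intro hlt
        exact h y hy (h1.symm.trans hs) (h2.trans hlt)
      · exact h w hw hs
  rw [vch, vch, hU, hm]

include hobs hch hlad in
lemma vch_choice : IsChoice X c (vch X c ch) := by
  refine ⟨fun Y _ => vch_subset Y, ?_, ?_⟩
  · intro Y hY x hx y hy
    exact Ymin_alloc hY x (vch_subset_min Y hx) y (vch_subset_min Y hy)
  · intro Y hY x hxX hxY hxc
    by_cases hxU : x ∈ Uset X c Y
    · exact (vch_insert_of_mem hY hxU hxY).symm
    have hY' : insert x Y ⊆ Xc X c := Finset.insert_subset hxX hY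
    -- x is minimal in insert x Y
    have hxm : ∀ y ∈ Y, y.2.1 = x.2.1 → x.2.2 < y.2.2 := by
      intro y hy hs
      by_contra hlt
      apply hxU
      refine mem_Uset.2 ⟨hxX, y, hy, hs.symm, ?_⟩
      rcases (not_lt.1 hlt).lt_or_eq with h | h
      · exact Or.inl h
      · exact Or.inr (Xc_ext X hxX (hY hy) hs.symm h.symm)
    have hxmin : x ∈ Ymin (insert x Y) := by
      refine mem_Ymin.2 ⟨Finset.mem_insert_self _ _, ?_⟩
      intro y hy hs
      rcases Finset.mem_insert.1 hy with rfl | hy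
      · exact lt_irrefl _
      · exact not_lt.2 (hxm y hy hs).le
    set U := Uset X c Y with hUd
    set U' := Uset X c (insert x Y) with hUd'
    have hUU : U ⊆ U' := Uset_mono (Finset.subset_insert _ _)
    set V := mvee X c ch U with hVd
    set V' := mvee X c ch U' with hVd'
    have hO : Obs X c ch V := obs_mvee hobs hch U
    have hO' : Obs X c ch V' := obs_mvee hobs hch U'
    have hVV : V ⊆ V' := le_mvee hO ((mvee_subset _).trans hUU)
    have hns' : ∀ y ∈ ch V', y.2.1 ≠ x.2.1 := by
      intro y hy hs
      exact hxc (mem_vch.2 ⟨hxmin, y, hy, hs⟩)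
    have hother : ∀ z ∈ U', z.2.1 ≠ x.2.1 → z ∈ U := by
      intro z hz hs
      obtain ⟨hzX, y, hy, h1, h2⟩ := mem_Uset.1 hz
      rcases Finset.mem_insert.1 hy with rfl | hy
      · exact absurd h1 hs
      · exact mem_Uset.2 ⟨hzX, y, hy, h1, h2⟩
    have hrej := hO.rej_mono hobs hch hO' hVV
    -- the student of x is not held at V
    have hns : ∀ y ∈ ch V, y.2.1 ≠ x.2.1 := by
      intro y hy hs
      have hVeq : V' = V := by
        by_contra hne
        have hr := hO.reach hobs hch hO' hVV
        rcases Relation.ReflTransGen.cases_head hr with h | ⟨W, ⟨z, hz, rfl⟩, hr'⟩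
        · exact hne h.symm
        · have hzV' : z ∈ V' := by
            have : ∀ A B, Reach X c ch A B → A ⊆ B := by
              intro A B h
              unfold Reach at h
              induction h with
              | refl => exact le_rfl
              | tail _ h ih =>
                obtain ⟨x, hx, rfl⟩ := h
                exact ih.trans (Finset.subset_insert _ _)
            exact this _ _ hr' (Finset.mem_insert_self _ _)
          have hzs : z.2.1 ≠ x.2.1 := fun h => hz.2.2.2 y hy (hs.trans h.symm)
          exact mvee_not_valid hobs hch (hother z (mvee_subset _ hzV') hzs) hz
      rw [hVeq] at hns'
      exact hns' y hy hs
    -- students held at V' are held at V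
    have hsub : (ch V').image (fun y => y.2.1) ⊆ (ch V).image (fun y => y.2.1) := by
      intro s hs
      obtain ⟨z, hz, rfl⟩ := Finset.mem_image.1 hs
      by_contra hn
      have hn' : ∀ y ∈ ch V, y.2.1 ≠ z.2.1 := fun y hy h =>
        hn (Finset.mem_image.2 ⟨y, hy, h⟩)
      have hzU : z ∈ U := hother z (mvee_subset _ (hch.1 _ hO'.subset hz)) (hns' z hz)
      have hzV := mvee_full hobs hch (Uset_subset Y) (Uset_up Y) hzU hn'
      have := hrej (Finset.mem_sdiff.2 ⟨hzV, fun h => hn' z h rfl⟩)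
      exact (Finset.mem_sdiff.1 this).2 hz
    have hcard : ∀ W, W ⊆ Xc X c → ((ch W).image (fun y => y.2.1)).card = (ch W).card := by
      intro W hW
      exact Finset.card_image_of_injOn fun a ha b hb h => hch.2.1 W hW a ha b hb h
    have heq : (ch V').image (fun y => y.2.1) = (ch V).image (fun y => y.2.1) := by
      refine Finset.eq_of_subset_of_card_le hsub ?_
      rw [hcard V hO.subset, hcard V' hO'.subset]
      exact hO.card_mono hobs hlad hch hO' hVV
    have hiff : ∀ s, (∃ y ∈ ch V', y.2.1 = s) ↔ (∃ y ∈ ch V, y.2.1 = s) := by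
      intro s
      have := Finset.ext_iff.1 heq s
      simpa only [Finset.mem_image] using this
    ext z
    rw [mem_vch, mem_vch, ← hUd, ← hUd', ← hVd, ← hVd', hiff]
    refine and_congr_left ?_
    rintro ⟨w, hw, hws⟩
    have hzs : z.2.1 ≠ x.2.1 := by rw [← hws]; exact hns w hw
    rw [mem_Ymin, mem_Ymin]
    constructor
    · rintro ⟨hz, h⟩
      refine ⟨Finset.mem_insert_of_mem hz, ?_⟩
      intro y hy hs
      rcases Finset.mem_insert.1 hy with rfl | hy
      · exact absurd hs.symm hzs
      · exact h y hy hs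
    · rintro ⟨hz, h⟩
      rcases Finset.mem_insert.1 hz with rfl | hz
      · exact absurd rfl hzs
      · exact ⟨hz, fun y hy => h y (Finset.mem_insert_of_mem hy)⟩

/-! ### Ranking of allocations -/

/-- contracts that would be chosen on top of `A` -/
noncomputable def Eset (X : Finset (C × S × T)) (c : C)
    (ch : Finset (C × S × T) → Finset (C × S × T))
    (A : Finset (C × S × T)) : Finset (C × S × T) :=
  (Xc X c).filter fun x => x ∉ A ∧ x ∈ vch X c ch (insert x A)

include hobs hch hlad in
lemma Eset_anti {W Y A : Finset (C × S × T)} (hY : Y ⊆ Xc X c) (hW : W ⊆ Y)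
    (hcW : vch X c ch Y ⊆ W) (hA : A ⊆ Y) : Eset X c ch W ⊆ Eset X c ch A := by
  have hv := vch_choice hobs hlad hch
  intro x hx
  simp only [Eset, Finset.mem_filter] at hx ⊢
  obtain ⟨hxX, hxW, hxc⟩ := hx
  have hxY : x ∉ Y := by
    intro hxY
    have := choice_irc hv (Finset.insert_subset hxY hW) hY
      (hcW.trans (Finset.subset_insert _ _))
    rw [this] at hxc
    exact hxW (hcW hxc)
  refine ⟨hxX, fun h => hxY (hA h), ?_⟩
  have hY' : insert x Y ⊆ Xc X c := Finset.insert_subset hxX hY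
  refine vch_subst hobs hch (Finset.insert_subset_insert x hA) hY'
    (Finset.mem_insert_self _ _) ?_
  by_contra hn
  have h1 := hv.2.2 Y hY x hxX hxY hn
  have h2 := choice_irc hv (Finset.insert_subset_insert x hW) hY'
    (by rw [← h1]; exact hcW.trans (Finset.subset_insert _ _))
  rw [h2] at hxc
  exact hn hxc

include hobs hch hlad in
lemma Eset_eq {Y A : Finset (C × S × T)} (hY : Y ⊆ Xc X c) (hA : A ⊆ Y)
    (h : Eset X c ch A ⊆ Eset X c ch (vch X c ch Y)) : vch X c ch Y ⊆ A := by
  intro b hb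
  by_contra hbA
  have hbY := vch_subset Y hb
  have h1 := vch_subst hobs hch (Finset.insert_subset hbY hA) hY (Finset.mem_insert_self _ _) hb
  have h2 : b ∈ Eset X c ch A := by
    simp only [Eset, Finset.mem_filter]
    exact ⟨hY hbY, hbA, h1⟩
  have h3 := h h2
  simp only [Eset, Finset.mem_filter] at h3
  exact h3.2.1 hb

include hobs hch hlad in
lemma Eset_mono {A B : Finset (C × S × T)} (hB : B ⊆ Xc X c) (hA : A ⊆ Uset X c B) :
    Eset X c ch B ⊆ Eset X c ch A := by
  refine Eset_anti hobs hlad hch (Uset_subset B) (subset_Uset hB) ?_ hA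
  intro x hx
  obtain ⟨hx, hm⟩ := mem_Ymin.1 (vch_subset_min _ hx)
  obtain ⟨hxX, y, hy, h1, h2⟩ := mem_Uset.1 hx
  rcases h2 with h2 | rfl
  · exact absurd h2 (hm y (subset_Uset hB hy) h1.symm)
  · exact hy

end obs

/-! ### Deferred acceptance equivalence -/

section da
variable {X}

lemma proposals_alloc {u : S → C × S × T → ℤ} (hu : ∀ s, IsPref X s (u s))
    (D : Finset (C × S × T)) : IsAlloc (proposals X u D) := by
  intro x hx y hy hs
  simp only [proposals, Finset.mem_filter] at hx hy
  by_contra hne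
  have hxX := (Finset.mem_sdiff.1 hx.1).1
  have hyX := (Finset.mem_sdiff.1 hy.1).1
  refine (hu x.2.1).2.1 x hxX y hyX rfl hs.symm hne ?_
  have h1 := hx.2.2 y hy.1 hs.symm
  have h2 := hy.2.2 x hx.1 hs
  rw [← hs] at h2
  exact le_antisymm h2 h1

/-- The invariant along the deferred acceptance algorithm. -/
def Inv (X : Finset (C × S × T)) (Ch : C → Finset (C × S × T) → Finset (C × S × T))
    (u : S → C × S × T → ℤ) (D : Finset (C × S × T)) : Prop :=
  ∀ c, ∃ Z, Obs X c (Ch c) Z ∧ (D.filter fun x => x.1 = c) = Z \ Ch c Z ∧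
    Ch c Z ⊆ proposals X u D

lemma Inv.main {Ch : C → Finset (C × S × T) → Finset (C × S × T)}
    (hCh : ∀ c, IsChoice X c (Ch c))
    (hobs : ∀ c, ObsSub X c (Ch c))
    (hlad : ∀ c, ObsLAD X c (Ch c))
    {u : S → C × S × T → ℤ} (hu : ∀ s, IsPref X s (u s))
    {D : Finset (C × S × T)} (hD : Inv X Ch u D) (c : C) :
    ∃ W, Obs X c (Ch c) W ∧ Ch c ((proposals X u D).filter fun x => x.1 = c) = Ch c W ∧
      vch X c (Ch c) ((proposals X u D).filter fun x => x.1 = c) = Ch c W ∧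
      W \ Ch c W = (D.filter fun x => x.1 = c) ∪
        (((proposals X u D).filter fun x => x.1 = c) \ Ch c W) ∧
      Disjoint D (Ch c W) ∧ Ch c W ⊆ (proposals X u D).filter fun x => x.1 = c := by
  obtain ⟨Z, hZ, hDZ, hP⟩ := hD c
  set P := (proposals X u D).filter fun x => x.1 = c with hPd
  have hchZ := (hCh c).1 Z hZ.subset
  have hZc : ∀ x ∈ Z, x.1 = c := fun x hx => (Finset.mem_filter.1 (hZ.subset hx)).2
  have hDmem : ∀ x, (x ∈ D ∧ x.1 = c) ↔ (x ∈ Z ∧ x ∉ Ch c Z) := by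
    intro x
    have := Finset.ext_iff.1 hDZ x
    simpa only [Finset.mem_filter, Finset.mem_sdiff] using this
  have hPX : P ⊆ Xc X c := by
    intro x hx
    simp only [hPd, proposals, Finset.mem_filter, Finset.mem_sdiff] at hx
    exact Finset.mem_filter.2 ⟨hx.1.1.1, hx.2⟩
  have hPZ : Ch c Z ⊆ P := fun x hx => Finset.mem_filter.2 ⟨hP hx, hZc x (hchZ hx)⟩
  have hW : Obs X c (Ch c) (Z ∪ P) := by
    refine hZ.union_valid (hobs c) (hCh c) ?_
    intro x hx
    by_cases hxZ : x ∈ Z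
    · exact Or.inl hxZ
    right
    refine ⟨hPX hx, hxZ, ?_, ?_⟩
    · intro y hy hs hlt
      have hyX := Finset.mem_filter.1 hy
      have hxX := Finset.mem_filter.1 (hPX hx)
      have hlt' := (hu x.2.1).2.2 y hyX.1 x hxX.1 hs rfl hlt
      by_contra hyZ
      have hyD : y ∉ D := fun h => hyZ ((hDmem y).1 ⟨h, hyX.2⟩).1
      have hxP := (Finset.mem_filter.1 hx).1
      simp only [proposals, Finset.mem_filter] at hxP
      exact absurd (hxP.2.2 y (Finset.mem_sdiff.2 ⟨hyX.1, hyD⟩) hs) (not_le.2 hlt')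
    · intro y hy hs
      have := proposals_alloc hu D y (hP hy) x (Finset.mem_filter.1 hx).1 hs
      subst this
      exact hxZ (hchZ hy)
  have hrej := hZ.rej_mono (hobs c) (hCh c) hW Finset.subset_union_left
  have hchW := (hCh c).1 _ hW.subset
  have hDW : ∀ x, x ∈ Z → x ∉ Ch c Z → x ∉ Ch c (Z ∪ P) := by
    intro x h1 h2
    exact (Finset.mem_sdiff.1 (hrej (Finset.mem_sdiff.2 ⟨h1, h2⟩))).2
  have hWP : Ch c (Z ∪ P) ⊆ P := by
    intro x hx
    rcases Finset.mem_union.1 (hchW hx) with h | h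
    · by_cases hxc : x ∈ Ch c Z
      · exact hPZ hxc
      · exact absurd hx (hDW x h hxc)
    · exact h
  refine ⟨Z ∪ P, hW, ?_, ?_, ?_, ?_, hWP⟩
  · exact choice_irc (hCh c) Finset.subset_union_right hW.subset hWP
  · have hv := vch_choice (hobs c) (hlad c) (hCh c)
    have e := vch_obs (hobs c) (hCh c) hW
    rw [choice_irc hv Finset.subset_union_right hW.subset (by rw [e]; exact hWP), e]
  · ext x
    simp only [Finset.mem_sdiff, Finset.mem_union, Finset.mem_filter]
    have h1 := hDmem x
    have h2 := hDW x
    have h3 := @hPZ x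
    tauto
  · rw [Finset.disjoint_left]
    intro x hx hxW
    have hxP := (Finset.mem_filter.1 (hWP hxW)).1
    simp only [proposals, Finset.mem_filter, Finset.mem_sdiff] at hxP
    exact hxP.1.2 hx

lemma Inv.held_eq {Ch : C → Finset (C × S × T) → Finset (C × S × T)}
    (hCh : ∀ c, IsChoice X c (Ch c))
    (hobs : ∀ c, ObsSub X c (Ch c))
    (hlad : ∀ c, ObsLAD X c (Ch c))
    {u : S → C × S × T → ℤ} (hu : ∀ s, IsPref X s (u s))
    {D : Finset (C × S × T)} (hD : Inv X Ch u D) :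
    held Ch (proposals X u D) = held (fun c => vch X c (Ch c)) (proposals X u D) := by
  ext x
  obtain ⟨W, -, h1, h2, -⟩ := hD.main hCh hobs hlad hu x.1
  simp only [held, Finset.mem_filter]
  rw [h1, h2]

lemma Inv.step {Ch : C → Finset (C × S × T) → Finset (C × S × T)}
    (hCh : ∀ c, IsChoice X c (Ch c))
    (hobs : ∀ c, ObsSub X c (Ch c))
    (hlad : ∀ c, ObsLAD X c (Ch c))
    {u : S → C × S × T → ℤ} (hu : ∀ s, IsPref X s (u s))
    {D : Finset (C × S × T)} (hD : Inv X Ch u D) :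
    Inv X Ch u (step X Ch u D) := by
  intro c
  obtain ⟨W, hW, h1, -, h2, h3, h4⟩ := hD.main hCh hobs hlad hu c
  refine ⟨W, hW, ?_, ?_⟩
  · rw [h2]
    ext x
    simp only [MWC.step, held, Finset.mem_filter, Finset.mem_union, Finset.mem_sdiff]
    constructor
    · rintro ⟨h, rfl⟩
      rw [h1] at h
      tauto
    · rintro (h | ⟨h, h'⟩)
      · tauto
      · obtain ⟨h, rfl⟩ := h
        rw [h1]
        tauto
  · intro x hx
    have hxP := Finset.mem_filter.1 (h4 hx)
    have hxP1 := hxP.1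
    have hxc := hxP.2
    simp only [proposals, Finset.mem_filter, Finset.mem_sdiff] at hxP1
    have hsub : D ⊆ MWC.step X Ch u D := Finset.subset_union_left
    simp only [proposals, Finset.mem_filter, Finset.mem_sdiff]
    refine ⟨⟨hxP1.1.1, ?_⟩, hxP1.2.1, fun y hy => hxP1.2.2 y ⟨hy.1, fun h => hy.2 (hsub h)⟩⟩
    intro hxs
    rcases Finset.mem_union.1 hxs with h | h
    · exact hxP1.1.2 h
    · refine (Finset.mem_sdiff.1 h).2 ?_
      refine Finset.mem_filter.2 ⟨hxP.1, ?_⟩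
      subst hxc
      rw [h1]; exact hx

lemma vch_DAeq {Ch : C → Finset (C × S × T) → Finset (C × S × T)}
    (hCh : ∀ c, IsChoice X c (Ch c))
    (hobs : ∀ c, ObsSub X c (Ch c))
    (hlad : ∀ c, ObsLAD X c (Ch c)) :
    DAeq X Ch (fun c => vch X c (Ch c)) := by
  intro u hu
  have key : ∀ n, (MWC.step X Ch u)^[n] ∅ = (MWC.step X (fun c => vch X c (Ch c)) u)^[n] ∅ ∧
      Inv X Ch u ((MWC.step X Ch u)^[n] ∅) := by
    intro n
    induction n with
    | zero =>
      refine ⟨rfl, fun c => ⟨∅, Relation.ReflTransGen.refl, ?_⟩⟩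
      have : Ch c ∅ = ∅ := Finset.subset_empty.1 ((hCh c).1 ∅ (by simp))
      simp [this]
    | succ n ih =>
      obtain ⟨i1, i2⟩ := ih
      rw [Function.iterate_succ_apply', Function.iterate_succ_apply']
      refine ⟨?_, i2.step hCh hobs hlad hu⟩
      rw [← i1]
      unfold MWC.step
      have := i2.held_eq hCh hobs hlad hu
      unfold MWC.step at this
      rw [this]
  obtain ⟨k1, k2⟩ := key (X.card + 1)
  unfold DA
  rw [k2.held_eq hCh hobs hlad hu, k1]

end da

/-! ### Salaries -/

section sal
variable [Fintype T]

/-- contracts outside `X` come first, then terms in their natural order -/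
def before (c : C) (s : S) (a b : T) : Prop :=
  ((c, s, a) ∉ X ∧ (c, s, b) ∈ X) ∨ (((c, s, a) ∈ X ↔ (c, s, b) ∈ X) ∧ a < b)

noncomputable def rk (x : C × S × T) : ℕ :=
  (Finset.univ.filter fun a => before X x.1 x.2.1 a x.2.2).card

noncomputable def sg (x : C × S × T) : ℝ := (rk X x : ℝ) + 1

noncomputable def Sl (T : Type*) [Fintype T] : Finset ℝ :=
  (Finset.range (Fintype.card T)).image fun k : ℕ => (k : ℝ) + 1

variable {X}

lemma before_trans {c : C} {s : S} {a b d : T} (h1 : before X c s a b) (h2 : before X c s b d) :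
    before X c s a d := by
  unfold before at *
  rcases h1 with h1 | h1 <;> rcases h2 with h2 | h2
  · tauto
  · tauto
  · tauto
  · exact Or.inr ⟨h1.1.trans h2.1, h1.2.trans h2.2⟩

lemma rk_lt {c : C} {s : S} {a b : T} (h : before X c s a b) : rk X (c, s, a) < rk X (c, s, b) := by
  unfold rk
  refine Finset.card_lt_card ?_
  rw [Finset.ssubset_iff_of_subset]
  · refine ⟨a, by simpa using h, ?_⟩
    intro hh
    have hh := (Finset.mem_filter.1 hh).2
    simp only [before] at hh
    rcases hh with hh | hh
    · exact hh.1 hh.2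
    · exact lt_irrefl _ hh.2
  · intro d hd
    simp only [Finset.mem_filter, Finset.mem_univ, true_and] at hd ⊢
    exact before_trans hd h

lemma before_total (c : C) (s : S) {a b : T} (h : a ≠ b) :
    before X c s a b ∨ before X c s b a := by
  unfold before
  rcases lt_or_gt_of_ne h with h | h <;> tauto

lemma rk_inj {c : C} {s : S} {a b : T} (h : rk X (c, s, a) = rk X (c, s, b)) : a = b := by
  by_contra hne
  rcases before_total (X := X) c s hne with h' | h'
  · exact absurd h (rk_lt h').ne
  · exact absurd h (rk_lt h').ne'

lemma before_of_rk {c : C} {s : S} {a b : T} (h : rk X (c, s, a) < rk X (c, s, b)) :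
    before X c s a b := by
  have hne : a ≠ b := by rintro rfl; exact lt_irrefl _ h
  rcases before_total (X := X) c s hne with h' | h'
  · exact h'
  · exact absurd h (rk_lt h').not_gt

lemma rk_bound (x : C × S × T) : rk X x < Fintype.card T := by
  unfold rk
  rw [← Finset.card_univ]
  refine Finset.card_lt_card ?_
  rw [Finset.ssubset_iff_of_subset (Finset.filter_subset _ _)]
  exact ⟨x.2.2, Finset.mem_univ _, by simp [before]⟩

lemma sg_mem (x : C × S × T) : sg X x ∈ Sl T :=
  Finset.mem_image.2 ⟨rk X x, Finset.mem_range.2 (rk_bound x), rfl⟩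

lemma Sl_pos {p : ℝ} (hp : p ∈ Sl T) : 0 < p := by
  obtain ⟨k, -, rfl⟩ := Finset.mem_image.1 hp
  positivity

lemma Sl_le {p : ℝ} (hp : p ∈ Sl T) : p ≤ Fintype.card T := by
  obtain ⟨k, hk, rfl⟩ := Finset.mem_image.1 hp
  have := Finset.mem_range.1 hk
  exact_mod_cast this

lemma sg_surj (c : C) (s : S) {p : ℝ} (hp : p ∈ Sl T) : ∃ t, sg X (c, s, t) = p := by
  obtain ⟨k, hk, rfl⟩ := Finset.mem_image.1 hp
  have hinj : Function.Injective
      (fun t : T => (⟨rk X (c, s, t), rk_bound _⟩ : Fin (Fintype.card T))) := by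
    intro a b h
    exact rk_inj (Fin.mk.inj_iff.1 h)
  have hb := (Fintype.bijective_iff_injective_and_card _).2 ⟨hinj, by simp⟩
  obtain ⟨t, ht⟩ := hb.2 ⟨k, Finset.mem_range.1 hk⟩
  have := Fin.mk.inj_iff.1 ht
  exact ⟨t, by simp [sg, this]⟩

lemma sg_inj {x y : C × S × T} (h1 : x.1 = y.1) (h2 : x.2.1 = y.2.1) (h : sg X x = sg X y) :
    x = y := by
  obtain ⟨c, s, a⟩ := x
  obtain ⟨c', s', b⟩ := y
  simp only at h1 h2
  subst h1 h2
  have : rk X (c, s, a) = rk X (c, s, b) := by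
    unfold sg at h
    exact_mod_cast add_right_cancel h
  rw [rk_inj this]

lemma sg_lt {x y : C × S × T} (h1 : x.1 = y.1) (h2 : x.2.1 = y.2.1) (h : sg X x < sg X y) :
    (x ∉ X ∧ y ∈ X) ∨ ((x ∈ X ↔ y ∈ X) ∧ x.2.2 < y.2.2) := by
  obtain ⟨c, s, a⟩ := x
  obtain ⟨c', s', b⟩ := y
  simp only at h1 h2
  subst h1 h2
  have : rk X (c, s, a) < rk X (c, s, b) := by
    unfold sg at h
    exact_mod_cast (add_lt_add_iff_right _).1 h
  exact before_of_rk this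

/-! ### College utilities -/

/-- contracts of college `c` corresponding to a set of worker-salary pairs -/
noncomputable def back (X : Finset (C × S × T)) (c : C) (Q : Finset (S × ℝ)) :
    Finset (C × S × T) :=
  (Xc X c).filter fun x => (x.2.1, sg X x) ∈ Q

lemma back_image {c : C} {A : Finset (C × S × T)} (hA : A ⊆ Xc X c) :
    back X c (A.image fun x => (x.2.1, sg X x)) = A := by
  ext x
  simp only [back, Finset.mem_filter, Finset.mem_image, Prod.mk.injEq]
  constructor
  · rintro ⟨hx, y, hy, h1, h2⟩
    have hyX := Finset.mem_filter.1 (hA hy)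
    have hxX := Finset.mem_filter.1 hx
    rw [← sg_inj (hyX.2.trans hxX.2.symm) h1 h2]; exact hy
  · intro hx
    exact ⟨hA hx, x, hx, rfl, rfl⟩

variable [Fintype S]

/-- a bound on the total of all salaries -/
noncomputable def KK (S T : Type*) [Fintype S] [Fintype T] : ℝ :=
  1 + ∑ q ∈ (Finset.univ : Finset S) ×ˢ Sl T, q.2

noncomputable def cu (X : Finset (C × S × T)) (c : C)
    (ch : Finset (C × S × T) → Finset (C × S × T)) (Q : Finset (S × ℝ)) : ℝ :=
  if Q ⊆ (Xc X c).image (fun x => (x.2.1, sg X x)) then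
    - KK S T * (Eset X c ch (back X c Q)).card - ∑ q ∈ Q, q.2
  else KK S T - ∑ q ∈ Q, q.2

lemma sum_nonneg' {Q : Finset (S × ℝ)} (hQ : ∀ q ∈ Q, q.2 ∈ Sl T) : 0 ≤ ∑ q ∈ Q, q.2 :=
  Finset.sum_nonneg fun q hq => (Sl_pos (hQ q hq)).le

lemma sum_lt_KK {Q : Finset (S × ℝ)} (hQ : ∀ q ∈ Q, q.2 ∈ Sl T) : ∑ q ∈ Q, q.2 < KK S T := by
  have : ∑ q ∈ Q, q.2 ≤ ∑ q ∈ (Finset.univ : Finset S) ×ˢ Sl T, q.2 := by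
    refine Finset.sum_le_sum_of_subset_of_nonneg ?_ ?_
    · intro q hq
      simp [hQ q hq]
    · intro q hq _
      exact (Sl_pos (Finset.mem_product.1 hq).2).le
  unfold KK; linarith

lemma lex_lt {K : ℝ} {m n : ℕ} {a b : ℝ} (ha : 0 ≤ a) (hb : b < K) (h : m < n) :
    - K * n - a < - K * m - b ∨ K ≤ 0 := by
  rcases le_or_gt K 0 with hK | hK
  · exact Or.inr hK
  · left
    have : (m : ℝ) + 1 ≤ n := by exact_mod_cast h
    nlinarith

lemma KK_pos : 0 < KK S T := by
  have := sum_lt_KK (S := S) (T := T) (Q := ∅) (by simp)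
  simpa using this

lemma cu_argmax {c : C} {ch : Finset (C × S × T) → Finset (C × S × T)}
    (hobs : ObsSub X c ch) (hlad : ObsLAD X c ch) (hch : IsChoice X c ch)
    {Y A : Finset (C × S × T)} (hY : Y ⊆ Xc X c) (hA : A ⊆ Ymin Y) (hne : A ≠ vch X c ch Y) :
    cu X c ch (A.image fun x => (x.2.1, sg X x)) <
      cu X c ch ((vch X c ch Y).image fun x => (x.2.1, sg X x)) := by
  have hAY : A ⊆ Y := hA.trans (Ymin_subset Y)
  have hAX := hAY.trans hY
  have hB : vch X c ch Y ⊆ Y := vch_subset Y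
  have hBX := hB.trans hY
  rw [cu, cu, if_pos (Finset.image_subset_image hAX), if_pos (Finset.image_subset_image hBX),
    back_image hAX, back_image hBX]
  have hQ : ∀ A : Finset (C × S × T), ∀ q ∈ A.image (fun x => (x.2.1, sg X x)), q.2 ∈ Sl T := by
    intro A q hq
    obtain ⟨x, -, rfl⟩ := Finset.mem_image.1 hq
    exact sg_mem x
  have hE := Eset_anti hobs hlad hch hY hB le_rfl hAY
  rcases (Finset.card_le_card hE).lt_or_eq with h | h
  · rcases lex_lt (sum_nonneg' (hQ A)) (sum_lt_KK (hQ (vch X c ch Y))) h with h | h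
    · exact h
    · exact absurd h (not_le.2 KK_pos)
  · have heq := Finset.eq_of_subset_of_card_le hE h.ge
    have hBA : vch X c ch Y ⊆ A := Eset_eq hobs hlad hch hY hAY heq.ge
    rw [heq]
    have hlt : ∑ q ∈ (vch X c ch Y).image (fun x => (x.2.1, sg X x)), q.2 <
        ∑ q ∈ A.image (fun x => (x.2.1, sg X x)), q.2 := by
      have hns : ¬ A ⊆ vch X c ch Y := fun h => hne (subset_antisymm h hBA)
      obtain ⟨a, ha, hab⟩ := Finset.not_subset.1 hns
      refine Finset.sum_lt_sum_of_subset (Finset.image_subset_image hBA)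
        (i := (a.2.1, sg X a)) (Finset.mem_image_of_mem _ ha) ?_ ?_ ?_
      · intro hh
        obtain ⟨b, hb, hb'⟩ := Finset.mem_image.1 hh
        simp only [Prod.mk.injEq] at hb'
        have := sg_inj ((Finset.mem_filter.1 (hBX hb)).2.trans
          (Finset.mem_filter.1 (hAX ha)).2.symm) hb'.1 hb'.2
        rw [this] at hb
        exact hab hb
      · exact Sl_pos (sg_mem a)
      · intro q hq _
        exact (Sl_pos (hQ A q hq)).le
    linarith

lemma cu_mono {c : C} {ch : Finset (C × S × T) → Finset (C × S × T)}
    (hobs : ObsSub X c ch) (hlad : ObsLAD X c ch) (hch : IsChoice X c ch)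
    (W' : Finset S) (p q : S → ℝ)
    (hp : ∀ s ∈ W', p s ∈ Sl T) (hq : ∀ s ∈ W', q s ∈ Sl T)
    (hle : ∀ s ∈ W', p s ≤ q s) (hlt : ∃ s ∈ W', p s < q s) :
    cu X c ch (W'.image fun s => (s, q s)) < cu X c ch (W'.image fun s => (s, p s)) := by
  have hS : ∀ r : S → ℝ, ∑ z ∈ W'.image (fun s => (s, r s)), z.2 = ∑ s ∈ W', r s := by
    intro r
    rw [Finset.sum_image]
    intro a _ b _ h
    exact (Prod.mk.inj h).1
  have hsum : ∑ s ∈ W', p s < ∑ s ∈ W', q s := Finset.sum_lt_sum hle hlt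
  have hQ : ∀ r : S → ℝ, (∀ s ∈ W', r s ∈ Sl T) →
      ∀ z ∈ W'.image (fun s => (s, r s)), z.2 ∈ Sl T := by
    intro r hr z hz
    obtain ⟨s, hs, rfl⟩ := Finset.mem_image.1 hz
    exact hr s hs
  have hpK := sum_lt_KK (hQ p hp)
  have hq0 := sum_nonneg' (hQ q hq)
  have hK := KK_pos (S := S) (T := T)
  rw [hS] at hpK hq0
  unfold cu
  rw [hS, hS]
  by_cases hqX : W'.image (fun s => (s, q s)) ⊆ (Xc X c).image (fun x => (x.2.1, sg X x))
  · rw [if_pos hqX]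
    by_cases hpX : W'.image (fun s => (s, p s)) ⊆ (Xc X c).image (fun x => (x.2.1, sg X x))
    · rw [if_pos hpX]
      have hE : Eset X c ch (back X c (W'.image fun s => (s, p s))) ⊆
          Eset X c ch (back X c (W'.image fun s => (s, q s))) := by
        refine Eset_mono hobs hlad hch (Finset.filter_subset _ _) ?_
        intro x hx
        obtain ⟨hxX, hx⟩ := Finset.mem_filter.1 hx
        obtain ⟨s, hs, hsx⟩ := Finset.mem_image.1 hx
        obtain ⟨y, hy, hys⟩ := Finset.mem_image.1
          (hpX (Finset.mem_image_of_mem (fun s => (s, p s)) hs))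
        simp only [Prod.mk.injEq] at hsx hys
        refine mem_Uset.2 ⟨hxX, y, ?_, hsx.1.symm.trans hys.1.symm, ?_⟩
        · refine Finset.mem_filter.2 ⟨hy, Finset.mem_image.2 ⟨s, hs, ?_⟩⟩
          rw [hys.1, hys.2]
        · have hc : y.1 = x.1 :=
            (Finset.mem_filter.1 hy).2.trans (Finset.mem_filter.1 hxX).2.symm
          have hss : y.2.1 = x.2.1 := hys.1.trans hsx.1
          have : sg X y ≤ sg X x := by rw [hys.2, ← hsx.2]; exact hle s hs
          rcases this.lt_or_eq with h | h
          · rcases sg_lt hc hss h with h | h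
            · exact absurd (Finset.mem_filter.1 hy).1 h.1
            · exact Or.inl h.2
          · exact Or.inr (sg_inj hc hss h).symm
      have hc : ((Eset X c ch (back X c (W'.image fun s => (s, p s)))).card : ℝ) ≤
          (Eset X c ch (back X c (W'.image fun s => (s, q s)))).card := by
        exact_mod_cast Finset.card_le_card hE
      nlinarith
    · rw [if_neg hpX]
      have : (0 : ℝ) ≤ (Eset X c ch (back X c (W'.image fun s => (s, q s)))).card := by positivity
      nlinarith
  · rw [if_neg hqX, if_neg]
    · linarith
    · intro hpX
      apply hqX
      intro z hz
      obtain ⟨s, hs, rfl⟩ := Finset.mem_image.1 hz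
      obtain ⟨y, hy, hys⟩ := Finset.mem_image.1
        (hpX (Finset.mem_image_of_mem (fun s => (s, p s)) hs))
      simp only [Prod.mk.injEq] at hys
      obtain ⟨t, ht⟩ := sg_surj (X := X) c s (hq s hs)
      have hyX := Finset.mem_filter.1 hy
      have : (c, s, t) ∈ X := by
        have hle' : sg X y ≤ sg X (c, s, t) := by rw [hys.2, ht]; exact hle s hs
        rcases hle'.lt_or_eq with h | h
        · rcases sg_lt (y := (c, s, t)) hyX.2 hys.1 h with h | h
          · exact h.2
          · exact h.1.1 hyX.1
        · rw [← sg_inj (y := (c, s, t)) hyX.2 hys.1 h]; exact hyX.1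
      exact Finset.mem_image.2 ⟨(c, s, t), Finset.mem_filter.2 ⟨this, rfl⟩, by simp [ht]⟩

/-! ### Student utilities -/

omit [Fintype S] in
lemma student_utils (u : S → C × S × T → ℤ) (hu : ∀ s, IsPref X s (u s)) :
    ∃ (uS : S → C × ℝ → ℝ) (oS : S → ℝ),
      (∀ (s : S) (c : C), ∀ p ∈ Sl T, ∀ q ∈ Sl T, p < q → uS s (c, p) < uS s (c, q)) ∧
      (∀ x ∈ X, ∀ x' ∈ X, x.2.1 = x'.2.1 →
        (u x.2.1 x' < u x.2.1 x ↔ uS x.2.1 (x'.1, sg X x') < uS x.2.1 (x.1, sg X x))) ∧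
      (∀ x ∈ X, (0 < u x.2.1 x ↔ oS x.2.1 < uS x.2.1 (x.1, sg X x))) ∧
      (∀ x : C × S × T, x ∉ X → uS x.2.1 (x.1, sg X x) < oS x.2.1) := by
  let M : S → ℝ := fun s => (Fintype.card T : ℝ) + 1 + ∑ x ∈ X, |(u s x : ℝ)|
  let uS : S → C × ℝ → ℝ := fun s cp =>
    if h : ∃ t, (cp.1, s, t) ∈ X ∧ sg X (cp.1, s, t) = cp.2 then
      (u s (cp.1, s, h.choose) : ℝ) else cp.2 - M s
  have h1 : ∀ x ∈ X, uS x.2.1 (x.1, sg X x) = u x.2.1 x := by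
    rintro ⟨c, s, t⟩ hx
    have h : ∃ t', (c, s, t') ∈ X ∧ sg X (c, s, t') = sg X (c, s, t) := ⟨t, hx, rfl⟩
    have e : uS s (c, sg X (c, s, t)) = (u s (c, s, h.choose) : ℝ) := dif_pos h
    have := sg_inj (x := (c, s, h.choose)) (y := (c, s, t)) rfl rfl h.choose_spec.2
    simp only
    rw [e, this]
  have h2 : ∀ x, x ∉ X → uS x.2.1 (x.1, sg X x) = sg X x - M x.2.1 := by
    rintro ⟨c, s, t⟩ hx
    refine dif_neg ?_
    rintro ⟨t', ht', hh⟩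
    have := sg_inj (x := (c, s, t')) (y := (c, s, t)) rfl rfl hh
    rw [this] at ht'
    exact hx ht'
  have hM0 : ∀ s, (0 : ℝ) ≤ ∑ x ∈ X, |(u s x : ℝ)| := fun s =>
    Finset.sum_nonneg fun _ _ => abs_nonneg _
  have hM : ∀ s, ∀ x ∈ X, -(u s x : ℝ) ≤ ∑ x ∈ X, |(u s x : ℝ)| := by
    intro s x hx
    exact (neg_le_abs _).trans
      (Finset.single_le_sum (f := fun x => |(u s x : ℝ)|) (fun _ _ => abs_nonneg _) hx)
  refine ⟨uS, fun _ => 0, ?_, ?_, ?_, ?_⟩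
  · intro s c p hp q hq hpq
    obtain ⟨a, rfl⟩ := sg_surj (X := X) c s hp
    obtain ⟨b, rfl⟩ := sg_surj (X := X) c s hq
    have := sg_lt (x := (c, s, a)) (y := (c, s, b)) rfl rfl hpq
    have ea1 := h1 (c, s, a)
    have ea2 := h2 (c, s, a)
    have eb1 := h1 (c, s, b)
    have eb2 := h2 (c, s, b)
    simp only at ea1 ea2 eb1 eb2 this
    by_cases ha : (c, s, a) ∈ X
    · have hb : (c, s, b) ∈ X := by tauto
      rw [ea1 ha, eb1 hb]
      have hab : a < b := by tauto
      exact_mod_cast (hu s).2.2 (c, s, b) hb (c, s, a) ha rfl rfl hab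
    · rw [ea2 ha]
      by_cases hb : (c, s, b) ∈ X
      · rw [eb1 hb]
        have k1 := hM s _ hb
        have k2 := Sl_le hp
        show _ - ((Fintype.card T : ℝ) + 1 + ∑ x ∈ X, |(u s x : ℝ)|) < _
        linarith
      · rw [eb2 hb]
        linarith
  · intro x hx x' hx' hs
    rw [h1 x hx]
    have := h1 x' hx'
    rw [← hs] at this
    rw [this]
    exact_mod_cast Iff.rfl
  · intro x hx
    rw [h1 x hx]
    exact Int.cast_pos.symm
  · intro x hx
    rw [h2 x hx]
    have k2 := Sl_le (sg_mem (X := X) x)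
    have := hM0 x.2.1
    show _ - ((Fintype.card T : ℝ) + 1 + ∑ y ∈ X, |(u x.2.1 y : ℝ)|) < 0
    linarith

end sal

/-- embedding into a Kelso-Crawford economy.  For every choice
profile under which contracts are observable substitutes and the observable law of
aggregate demand holds, there are a DA-equivalent choice profile `Ch'`, a finite
positive salary set, salaries for the contracts (identifying colleges with firms
and students with workers), firm utilities strictly decreasing in salaries whose
maximization induces `Ch'`, and, for every monotone strict preference profile,
worker utilities strictly increasing in salaries representing the students'
preferences, with non-contracts worse than the outside option. -/
theorem statement_14 [Fintype C] [Fintype S] [Fintype T]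
    (X : Finset (C × S × T)) (Ch : C → Finset (C × S × T) → Finset (C × S × T))
    (hCh : ∀ c, IsChoice X c (Ch c))
    (hobs : ∀ c, ObsSub X c (Ch c))
    (hlad : ∀ c, ObsLAD X c (Ch c)) :
    ∃ Ch' : C → Finset (C × S × T) → Finset (C × S × T),
      (∀ c, IsChoice X c (Ch' c)) ∧ DAeq X Ch Ch' ∧
      ∃ (Sal : Finset ℝ) (σ : C × S × T → ℝ) (uC : C → Finset (S × ℝ) → ℝ),
        (∀ p ∈ Sal, 0 < p) ∧
        (∀ x : C × S × T, σ x ∈ Sal) ∧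
        -- the map (c,s,t) ↦ (c,s,σ(c,s,t)) is a bijection onto C × S × Sal
        Function.Injective (fun x : C × S × T => (x.1, x.2.1, σ x)) ∧
        (∀ (c : C) (s : S), ∀ p ∈ Sal, ∃ t : T, σ (c, s, t) = p) ∧
        -- firm utilities are strictly decreasing in salaries
        (∀ (c : C) (W' : Finset S) (p q : S → ℝ),
          (∀ s ∈ W', p s ∈ Sal) → (∀ s ∈ W', q s ∈ Sal) →
          (∀ s ∈ W', p s ≤ q s) → (∃ s ∈ W', p s < q s) →
          uC c (W'.image fun s => (s, q s)) < uC c (W'.image fun s => (s, p s))) ∧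
        -- `Ch'` is induced by maximization of the firm's utility over `Y^min`
        (∀ c, ∀ Y, Y ⊆ Xc X c →
          Ch' c Y ⊆ Ymin Y ∧
          ∀ A, A ⊆ Ymin Y → A ≠ Ch' c Y →
            uC c (A.image fun x => (x.2.1, σ x)) <
              uC c ((Ch' c Y).image fun x => (x.2.1, σ x))) ∧
        -- for each monotone strict preference profile there are representing
        -- worker utilities
        (∀ u : S → C × S × T → ℤ, (∀ s, IsPref X s (u s)) →
          ∃ (uS : S → C × ℝ → ℝ) (oS : S → ℝ),
            (∀ (s : S) (c : C), ∀ p ∈ Sal, ∀ q ∈ Sal, p < q →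
              uS s (c, p) < uS s (c, q)) ∧
            (∀ x ∈ X, ∀ x' ∈ X, x.2.1 = x'.2.1 →
              (u x.2.1 x' < u x.2.1 x ↔
                uS x.2.1 (x'.1, σ x') < uS x.2.1 (x.1, σ x))) ∧
            (∀ x ∈ X, (0 < u x.2.1 x ↔ oS x.2.1 < uS x.2.1 (x.1, σ x))) ∧
            (∀ x : C × S × T, x ∉ X → uS x.2.1 (x.1, σ x) < oS x.2.1)) := by
  refine ⟨fun c => vch X c (Ch c), fun c => vch_choice (hobs c) (hlad c) (hCh c),
    vch_DAeq hCh hobs hlad, Sl T, sg X, fun c => cu X c (Ch c), fun p hp => Sl_pos hp, sg_mem,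
    ?_, fun c s p hp => sg_surj c s hp, ?_, ?_, student_utils⟩
  · intro x y h
    simp only [Prod.mk.injEq] at h
    exact sg_inj h.1 h.2.1 h.2.2
  · intro c W' p q hp hq hle hlt
    exact cu_mono (hobs c) (hlad c) (hCh c) W' p q hp hq hle hlt
  · intro c Y hY
    exact ⟨vch_subset_min Y, fun A hA hne => cu_argmax (hobs c) (hlad c) (hCh c) hY hA hne⟩


end MWC
end

section
/- Suppose contracts are observable substitutes for monotone preferences under Ch_c, Ch_c is monotone in contract terms, and Ch_c is demand-invariant. Then the virtual choice function Ch'_c coincides with Ch_c, i.e., Ch'_c(Y) = Ch_c(Y) for all Y ⊆ X_c. In particular, if a profile Ch of such choice functions is DA-equivalent to a profile Ch' under which contracts are substitutes, then Ch' can be chosen equal to Ch. -/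
open scoped Classical

namespace MWC

variable {C S T : Type*} [DecidableEq C] [DecidableEq S] [DecidableEq T] [LinearOrder T]

/-! Contracts are triples `(college, student, term)`.  For `x : C × S × T`,
`x.1` is the college, `x.2.1` the student and `x.2.2` the contract term.
The linear order on `T` plays the role of `▷`: higher terms are better for students. -/

variable (X : Finset (C × S × T))

/-- `Ch` is demand-invariant for college `c`. -/
def DemandInv (X : Finset (C × S × T)) (c : C)
    (Ch : Finset (C × S × T) → Finset (C × S × T)) : Prop :=
  ∀ Z Y, Z ⊆ Y → Y ⊆ Xc X c →
    (∀ s : S, s ∉ (Ch Z).image (fun x => x.2.1) →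
      Z.filter (fun x => x.2.1 = s) = Y.filter fun x => x.2.1 = s) →
    (Ch Y).image (fun x => x.2.1) = (Ch Z).image fun x => x.2.1

theorem aux_irc (X : Finset (C × S × T)) (c : C) (Ch : Finset (C × S × T) → Finset (C × S × T))
    (hCh : IsChoice X c Ch) (Y : Finset (C × S × T)) :
    ∀ n : ℕ, ∀ W, W ⊆ Xc X c → Y ⊆ W → Ch W ⊆ Y → (W \ Y).card = n → Ch Y = Ch W := by
  intro n
  induction n with
  | zero =>
    intro W hW hYW _ hc
    have h1 : W \ Y = ∅ := Finset.card_eq_zero.mp hc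
    have h2 : W ⊆ Y := Finset.sdiff_eq_empty_iff_subset.mp h1
    rw [Finset.Subset.antisymm hYW h2]
  | succ n ih =>
    intro W hW hYW hch hc
    have hne : (W \ Y).Nonempty := by
      rw [← Finset.card_pos]; omega
    obtain ⟨x, hx⟩ := hne
    have hxW := (Finset.mem_sdiff.mp hx).1
    have hxY := (Finset.mem_sdiff.mp hx).2
    have hins : insert x (W.erase x) = W := Finset.insert_erase hxW
    have hE : W.erase x ⊆ Xc X c := (Finset.erase_subset _ _).trans hW
    have h3 := hCh.2.2 (W.erase x) hE x (hW hxW) (Finset.notMem_erase x W)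
      (by rw [hins]; exact fun h => hxY (hch h))
    rw [hins] at h3
    rw [← h3]
    apply ih _ hE
    · intro y hy
      exact Finset.mem_erase.mpr ⟨fun h => hxY (h ▸ hy), hYW hy⟩
    · rw [h3]; exact hch
    · have : W.erase x \ Y = (W \ Y).erase x := by
        ext y; simp only [Finset.mem_sdiff, Finset.mem_erase]; tauto
      rw [this, Finset.card_erase_of_mem hx, hc]; rfl

/-- Admissible sequences. -/
def AuxGood (X : Finset (C × S × T)) (c : C) (Ch : Finset (C × S × T) → Finset (C × S × T))
    (L : List (C × S × T)) : Prop :=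
  L.Nodup ∧ SeqIn X c L ∧ GenMono X c L ∧ ObsSeq Ch L

/-- Saturation of `V` in `W`. -/
def AuxSat (Ch : Finset (C × S × T) → Finset (C × S × T)) (V W : Finset (C × S × T)) : Prop :=
  ∀ s : S, s ∉ (Ch V).image (fun x => x.2.1) →
      V.filter (fun x => x.2.1 = s) = W.filter fun x => x.2.1 = s

theorem aux_mem_Xc {X : Finset (C × S × T)} {c : C} {x y : C × S × T}
    (hx : x ∈ Xc X c) (hy : y ∈ Xc X c) (h1 : x.2.1 = y.2.1) (h2 : x.2.2 = y.2.2) : x = y := by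
  have hx1 := (Finset.mem_filter.mp hx).2
  have hy1 := (Finset.mem_filter.mp hy).2
  exact Prod.ext (hx1.trans hy1.symm) (Prod.ext h1 h2)

theorem aux_step (X : Finset (C × S × T)) (c : C) (Ch : Finset (C × S × T) → Finset (C × S × T))
    (Y : Finset (C × S × T)) (L : List (C × S × T)) (hL : AuxGood X c Ch L)
    (hLU : L.toFinset ⊆ Uset X c Y) (hns : ¬ AuxSat Ch L.toFinset (Uset X c Y)) :
    ∃ x ∈ Uset X c Y, x ∉ L ∧ AuxGood X c Ch (L ++ [x]) := by
  unfold AuxSat at hns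
  push Not at hns
  obtain ⟨s, hs, hne⟩ := hns
  have hex : ((Uset X c Y).filter (fun x => x.2.1 = s ∧ x ∉ L)).Nonempty := by
    by_contra hemp
    rw [Finset.not_nonempty_iff_eq_empty] at hemp
    apply hne
    ext y
    simp only [Finset.mem_filter]
    constructor
    · rintro ⟨h1, h2⟩; exact ⟨hLU h1, h2⟩
    · rintro ⟨h1, h2⟩
      refine ⟨?_, h2⟩
      by_contra h3
      have : y ∈ (Uset X c Y).filter (fun x => x.2.1 = s ∧ x ∉ L) :=
        Finset.mem_filter.mpr ⟨h1, h2, fun h => h3 (List.mem_toFinset.mpr h)⟩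
      rw [hemp] at this
      exact Finset.notMem_empty _ this
  obtain ⟨x, hx, hmax⟩ := Finset.exists_max_image _ (fun x => x.2.2) hex
  obtain ⟨hxU, hxs, hxL⟩ := Finset.mem_filter.mp hx
  obtain ⟨hnd, hin, hgen, hob⟩ := hL
  have hxX : x ∈ Xc X c := (Finset.mem_filter.mp hxU).1
  refine ⟨x, hxU, hxL, ?_, ?_, ?_, ?_⟩
  · rw [List.nodup_append]
    refine ⟨hnd, by simp, ?_⟩
    intro a ha b hb
    rw [List.mem_singleton] at hb
    rintro rfl
    exact hxL (hb ▸ ha)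
  · intro y hy
    rcases List.mem_append.mp hy with h | h
    · exact hin y h
    · rw [List.mem_singleton.mp h]; exact hxX
  · intro t ht y hy hys hyt
    by_cases htl : t < L.length
    · have e : (L ++ [x]).get ⟨t, ht⟩ = L.get ⟨t, htl⟩ := by
        simp [List.getElem_append_left htl]
      rw [e] at hys hyt
      have := hgen t htl y hy hys hyt
      rwa [List.take_append_of_le_length htl.le]
    · have hte : t = L.length := by
        simp only [List.length_append, List.length_singleton] at ht; omega
      subst hte
      have e : (L ++ [x]).get ⟨L.length, ht⟩ = x := by simp
      rw [e] at hys hyt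
      rw [List.take_append_of_le_length le_rfl, List.take_length]
      by_contra hyL
      have hyU : y ∈ Uset X c Y := by
        obtain ⟨_, z, hz, hz1, hz2⟩ := Finset.mem_filter.mp hxU
        refine Finset.mem_filter.mpr ⟨hy, z, hz, hys.trans hz1, Or.inl ?_⟩
        rcases hz2 with h | h
        · exact h.trans hyt
        · rw [← h]; exact hyt
      have := hmax y (Finset.mem_filter.mpr ⟨hyU, hys.trans hxs, hyL⟩)
      exact absurd hyt (not_lt.mpr this)
  · intro t ht h0
    by_cases htl : t < L.length
    · have e : (L ++ [x]).get ⟨t, ht⟩ = L.get ⟨t, htl⟩ := by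
        simp [List.getElem_append_left htl]
      rw [e, List.take_append_of_le_length htl.le]
      exact hob t htl h0
    · have hte : t = L.length := by
        simp only [List.length_append, List.length_singleton] at ht; omega
      subst hte
      have e : (L ++ [x]).get ⟨L.length, ht⟩ = x := by simp
      rw [e, List.take_append_of_le_length le_rfl, List.take_length, hxs]
      exact hs

theorem aux_append_sub {L : List (C × S × T)} {x : C × S × T} {U : Finset (C × S × T)}
    (hL : L.toFinset ⊆ U) (hx : x ∈ U) : (L ++ [x]).toFinset ⊆ U := by
  intro y hy
  rcases List.mem_append.mp (List.mem_toFinset.mp hy) with h | h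
  · exact hL (List.mem_toFinset.mpr h)
  · rw [List.mem_singleton.mp h]; exact hx

theorem aux_extend (X : Finset (C × S × T)) (c : C) (Ch : Finset (C × S × T) → Finset (C × S × T))
    (Y : Finset (C × S × T)) : ∀ n : ℕ, ∀ L : List (C × S × T), AuxGood X c Ch L →
    L.toFinset ⊆ Uset X c Y → (Uset X c Y).card ≤ n + L.length →
    ∃ M, AuxGood X c Ch (L ++ M) ∧ (L ++ M).toFinset ⊆ Uset X c Y ∧
      AuxSat Ch (L ++ M).toFinset (Uset X c Y) := by
  intro n
  induction n with
  | zero =>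
    intro L hL hLU hc
    refine ⟨[], by simpa using hL, by simpa using hLU, ?_⟩
    have : L.toFinset = Uset X c Y := by
      apply Finset.eq_of_subset_of_card_le hLU
      rw [List.toFinset_card_of_nodup hL.1]; omega
    rw [List.append_nil, this]
    intro s _; rfl
  | succ n ih =>
    intro L hL hLU hc
    by_cases hs : AuxSat Ch L.toFinset (Uset X c Y)
    · exact ⟨[], by simpa using hL, by simpa using hLU, by simpa using hs⟩
    · obtain ⟨x, hxU, hxL, hg⟩ := aux_step X c Ch Y L hL hLU hs
      obtain ⟨M, h1, h2, h3⟩ := ih (L ++ [x]) hg (aux_append_sub hLU hxU)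
        (by simp only [List.length_append, List.length_singleton]; omega)
      refine ⟨[x] ++ M, ?_, ?_, ?_⟩ <;> rw [← List.append_assoc] <;> assumption

theorem aux_max_sat (X : Finset (C × S × T)) (c : C)
    (Ch : Finset (C × S × T) → Finset (C × S × T)) (Y V : Finset (C × S × T))
    (hV : MaxObsSubset X c Ch (Uset X c Y) V) : AuxSat Ch V (Uset X c Y) := by
  obtain ⟨hVU, ⟨L, hnd, rfl, h1, h2, h3⟩, hmax⟩ := hV
  by_contra hns
  obtain ⟨x, hxU, hxL, hg⟩ := aux_step X c Ch Y L ⟨hnd, h1, h2, h3⟩ hVU hns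
  have := hmax (L ++ [x]).toFinset ⟨_, hg.1, rfl, hg.2.1, hg.2.2.1, hg.2.2.2⟩
    (by intro y hy; simp only [List.mem_toFinset, List.mem_append] at hy ⊢; exact Or.inl hy)
    (aux_append_sub hVU hxU)
  apply hxL
  rw [← List.mem_toFinset, ← this]
  simp

theorem aux_nil (X : Finset (C × S × T)) (c : C)
    (Ch : Finset (C × S × T) → Finset (C × S × T)) : AuxGood X c Ch [] := by
  refine ⟨List.nodup_nil, ?_, ?_, ?_⟩
  · intro x hx; exact absurd hx (by simp)
  · intro t ht; exact absurd ht (by simp)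
  · intro t ht; exact absurd ht (by simp)

theorem aux_max_exists (X : Finset (C × S × T)) (c : C)
    (Ch : Finset (C × S × T) → Finset (C × S × T)) (U : Finset (C × S × T)) :
    ∃ V, MaxObsSubset X c Ch U V := by
  have hne : (U.powerset.filter (fun V => ObsSet X c Ch V)).Nonempty := by
    refine ⟨∅, Finset.mem_filter.mpr ⟨by simp, [], ?_⟩⟩
    obtain ⟨a, b, d, e⟩ := aux_nil X c Ch
    exact ⟨a, by simp, b, d, e⟩
  obtain ⟨V, hV, hmax⟩ := Finset.exists_max_image _ Finset.card hne
  obtain ⟨h1, h2⟩ := Finset.mem_filter.mp hV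
  refine ⟨V, Finset.mem_powerset.mp h1, h2, ?_⟩
  intro Y' hY' hsub hU
  have := hmax Y' (Finset.mem_filter.mpr ⟨Finset.mem_powerset.mpr hU, hY'⟩)
  exact (Finset.eq_of_subset_of_card_le hsub this).symm

theorem aux_sub_U {X : Finset (C × S × T)} {c : C} {Y : Finset (C × S × T)} (hY : Y ⊆ Xc X c) :
    Y ⊆ Uset X c Y :=
  fun y hy => Finset.mem_filter.mpr ⟨hY hy, y, hy, rfl, Or.inr rfl⟩

theorem aux_U_sub {X : Finset (C × S × T)} {c : C} {Y : Finset (C × S × T)} :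
    Uset X c Y ⊆ Xc X c := Finset.filter_subset _ _

theorem aux_ChU (X : Finset (C × S × T)) (c : C)
    (Ch : Finset (C × S × T) → Finset (C × S × T)) (hCh : IsChoice X c Ch)
    (hmono : MonotoneCh X c Ch) (Y : Finset (C × S × T)) (hY : Y ⊆ Xc X c) :
    Ch Y = Ch (Uset X c Y) := by
  refine aux_irc X c Ch hCh Y _ _ aux_U_sub (aux_sub_U hY) ?_ rfl
  intro x hx
  obtain ⟨hxU, hmin⟩ := Finset.mem_filter.mp (hmono _ aux_U_sub hx)
  obtain ⟨_, y, hy, h1, h2⟩ := Finset.mem_filter.mp hxU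
  rcases h2 with h | h
  · exact absurd h (hmin y (aux_sub_U hY hy) h1.symm)
  · rw [h]; exact hy

theorem aux_image (X : Finset (C × S × T)) (c : C)
    (Ch : Finset (C × S × T) → Finset (C × S × T)) (hCh : IsChoice X c Ch)
    (hmono : MonotoneCh X c Ch) (hdem : DemandInv X c Ch)
    (Y : Finset (C × S × T)) (hY : Y ⊆ Xc X c) (V : Finset (C × S × T))
    (hVU : V ⊆ Uset X c Y) (hsat : AuxSat Ch V (Uset X c Y)) :
    (Ch Y).image (fun x => x.2.1) = (Ch V).image (fun x => x.2.1) := by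
  rw [aux_ChU X c Ch hCh hmono Y hY]
  exact hdem V _ hVU aux_U_sub hsat

theorem aux_char (X : Finset (C × S × T)) (c : C)
    (Ch : Finset (C × S × T) → Finset (C × S × T))
    (hmono : MonotoneCh X c Ch) (Y : Finset (C × S × T)) (hY : Y ⊆ Xc X c)
    (x : C × S × T) (hx : x ∈ Ymin Y) (hs : x.2.1 ∈ (Ch Y).image (fun x => x.2.1)) :
    x ∈ Ch Y := by
  obtain ⟨y, hy, hys⟩ := Finset.mem_image.mp hs
  obtain ⟨hyY, hymin⟩ := Finset.mem_filter.mp (hmono Y hY hy)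
  obtain ⟨hxY, hxmin⟩ := Finset.mem_filter.mp hx
  have h1 := hymin x hxY hys.symm
  have h2 := hxmin y hyY hys
  have : x = y := aux_mem_Xc (hY hxY) (hY hyY) hys.symm
    (le_antisymm (not_lt.mp h2) (not_lt.mp h1))
  rw [this]; exact hy

theorem aux_virtual (X : Finset (C × S × T)) (c : C)
    (Ch : Finset (C × S × T) → Finset (C × S × T)) (hCh : IsChoice X c Ch)
    (hmono : MonotoneCh X c Ch) (hdem : DemandInv X c Ch)
    (Y : Finset (C × S × T)) (hY : Y ⊆ Xc X c) : virtualChoice X c Ch Y = Ch Y := by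
  have hex := aux_max_exists X c Ch (Uset X c Y)
  have hv : MaxObsSubset X c Ch (Uset X c Y) (vee X c Ch Y) := by
    unfold vee; rw [dif_pos hex]; exact hex.choose_spec
  have him := aux_image X c Ch hCh hmono hdem Y hY _ hv.1 (aux_max_sat X c Ch Y _ hv)
  ext x
  unfold virtualChoice
  rw [Finset.mem_filter, ← him]
  constructor
  · rintro ⟨h1, h2⟩; exact aux_char X c Ch hmono Y hY x h1 h2
  · intro h; exact ⟨hmono Y hY h, Finset.mem_image_of_mem _ h⟩

theorem aux_rej (X : Finset (C × S × T)) (c : C)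
    (Ch : Finset (C × S × T) → Finset (C × S × T)) (hobs : ObsSub X c Ch)
    (L : List (C × S × T)) (hL : AuxGood X c Ch L) (k : ℕ) :
    ∀ n, k + n ≤ L.length → Rej Ch (L.take k).toFinset ⊆ Rej Ch (L.take (k + n)).toFinset := by
  intro n
  induction n with
  | zero => intro _; exact Finset.Subset.refl _
  | succ n ih =>
    intro h
    exact (ih (by omega)).trans (hobs L hL.2.1 hL.2.2.1 hL.2.2.2 (k + n) h)

theorem aux_subst (X : Finset (C × S × T)) (c : C)
    (Ch : Finset (C × S × T) → Finset (C × S × T)) (hCh : IsChoice X c Ch)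
    (hobs : ObsSub X c Ch) (hmono : MonotoneCh X c Ch) (hdem : DemandInv X c Ch)
    (A B : Finset (C × S × T)) (hAB : A ⊆ B) (hB : B ⊆ Xc X c) (x : C × S × T)
    (hxA : x ∈ A) (hx : x ∈ Ch B) : x ∈ Ch A := by
  have hA := hAB.trans hB
  obtain ⟨hxB, hxmin⟩ := Finset.mem_filter.mp (hmono B hB hx)
  apply aux_char X c Ch hmono A hA x
    (Finset.mem_filter.mpr ⟨hxA, fun y hy => hxmin y (hAB hy)⟩)
  by_contra hns
  have hUU : Uset X c A ⊆ Uset X c B := by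
    intro y hy
    obtain ⟨h1, z, hz, h2⟩ := Finset.mem_filter.mp hy
    exact Finset.mem_filter.mpr ⟨h1, z, hAB hz, h2⟩
  obtain ⟨L, hg, hLU, hsat⟩ := aux_extend X c Ch A _ [] (aux_nil X c Ch) (by simp)
    (Nat.le_add_right _ _)
  rw [List.nil_append] at hg hLU hsat
  obtain ⟨M, hg2, hLU2, hsat2⟩ := aux_extend X c Ch B _ L hg (hLU.trans hUU)
    (Nat.le_add_right _ _)
  rw [aux_image X c Ch hCh hmono hdem A hA _ hLU hsat] at hns
  have hin : x.2.1 ∈ (Ch B).image (fun x => x.2.1) := Finset.mem_image_of_mem _ hx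
  rw [aux_image X c Ch hCh hmono hdem B hB _ hLU2 hsat2] at hin
  obtain ⟨y, hy, hys⟩ := Finset.mem_image.mp hin
  have hyU : y ∈ Uset X c B := hLU2 (hCh.1 _ (hLU2.trans aux_U_sub) hy)
  obtain ⟨hyX, z, hz, hyz, hlt⟩ := Finset.mem_filter.mp hyU
  have hzx : x.2.2 ≤ z.2.2 := not_lt.mp (hxmin z hz (hyz.symm.trans hys))
  have hyx : x.2.2 ≤ y.2.2 := by
    rcases hlt with h | h
    · exact hzx.trans h.le
    · rw [h]; exact hzx
  have hyA : y ∈ Uset X c A := by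
    refine Finset.mem_filter.mpr ⟨hyX, x, hxA, hys, ?_⟩
    rcases hyx.lt_or_eq with h | h
    · exact Or.inl h
    · exact Or.inr (aux_mem_Xc hyX (hA hxA) hys h.symm)
  have hyL : y ∈ L.toFinset := by
    have : y ∈ L.toFinset.filter (fun w => w.2.1 = x.2.1) := by
      rw [hsat _ hns]; exact Finset.mem_filter.mpr ⟨hyA, hys⟩
    exact (Finset.mem_filter.mp this).1
  have hyR : y ∈ Rej Ch L.toFinset :=
    Finset.mem_sdiff.mpr ⟨hyL, fun h => hns (Finset.mem_image.mpr ⟨y, h, hys⟩)⟩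
  have hr := aux_rej X c Ch hobs (L ++ M) hg2 L.length M.length (by simp)
  rw [List.take_append_of_le_length le_rfl, List.take_length, ← List.length_append,
    List.take_length] at hr
  exact (Finset.mem_sdiff.mp (hr hyR)).2 hy

/-- for observably substitutable choice functions that are monotone
in contract terms and demand-invariant, the virtual choice function coincides with
the original one; in particular, if such a profile is DA-equivalent to a profile
under which contracts are substitutes, then the original profile itself can serve
as the equivalent profile, i.e. contracts are substitutes under it. -/
theorem statement_15 [Fintype C] [Fintype S] [Fintype T]
    (X : Finset (C × S × T)) (Ch : C → Finset (C × S × T) → Finset (C × S × T))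
    (hCh : ∀ c, IsChoice X c (Ch c))
    (hobs : ∀ c, ObsSub X c (Ch c))
    (hmono : ∀ c, MonotoneCh X c (Ch c))
    (hdem : ∀ c, DemandInv X c (Ch c)) :
    (∀ c, ∀ Y, Y ⊆ Xc X c → virtualChoice X c (Ch c) Y = Ch c Y) ∧
    (∀ Ch'' : C → Finset (C × S × T) → Finset (C × S × T),
      (∀ c, IsChoice X c (Ch'' c)) → (∀ c, Substitutes X c (Ch'' c)) →
      DAeq X Ch Ch'' → ∀ c, Substitutes X c (Ch c)) := by
  refine ⟨fun c Y hY => aux_virtual X c (Ch c) (hCh c) (hmono c) (hdem c) Y hY, ?_⟩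
  intro _ _ _ _ c Y hY x hx z hz _ _ h
  refine aux_subst X c (Ch c) (hCh c) (hobs c) (hmono c) (hdem c) (insert x Y)
    (insert z (insert x Y)) (Finset.subset_insert _ _) ?_ x (Finset.mem_insert_self _ _) h
  exact Finset.insert_subset hz (Finset.insert_subset hx hY)

end MWC
end
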